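/- Let n ≥ 3, 0 < m < (n-2)/n, R_1 > 0 and T_1 > 0. Let u_1, u_2 be positive functions on (ℝ^n \ B_{R_1}) × [0,T_1], continuous there, which are C^{2,1} on (ℝ^n \ cl(B_{R_1})) × (0,T_1] and satisfy u_t = Δ(u^m) there. Assume: (i) u_1(x,0) ≤ u_2(x,0) for all |x| ≥ R_1; (ii) u_1(x,t) < u_2(x,t) for all |x| = R_1 and 0 < t ≤ T_1; (iii) there is a constant c_0 > 0 with min(u_1(x,t), u_2(x,t)) ≥ c_0 |x|^{−2/(1−m)} for all |x| ≥ R_1 and 0 ≤ t ≤ T_1; and (iv) the positive part (u_1 − u_2)_+ belongs to L¹((0,T_1); L¹(ℝ^n \ cl(B_{R_1}))). Then u_1(x,t) < u_2(x,t) for all |x| > R_1 and 0 < t ≤ T_1. -/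

import Mathlib

open Real Filter MeasureTheory Set Topology

noncomputable section

def Cstar (n : ℕ) (m : ℝ) : ℝ := 2 * m * ((n : ℝ) - 2 - n * m) / (1 - m)

def beta1 (n : ℕ) (m : ℝ) : ℝ := 1 / ((n : ℝ) - 2 - n * m)

def betaE (n : ℕ) (m : ℝ) : ℝ := m / ((n : ℝ) - 2 - n * m)

def beta2 (n : ℕ) (m : ℝ) : ℝ :=
  Real.sqrt (2 * (1 - m) / ((n : ℝ) - 2 - n * m)) +
    (((n : ℝ) + 2) * m - ((n : ℝ) - 2)) / (2 * ((n : ℝ) - 2 - n * m))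

def beta0 (n : ℕ) (m : ℝ) : ℝ := max (beta2 n m) (betaE n m)

def A0 (n : ℕ) (m β : ℝ) : ℝ :=
  (n : ℝ) - 2 - ((n : ℝ) + 2) * m + 2 * β * ((n : ℝ) - 2 - n * m)

def gamma1 (n : ℕ) (m β : ℝ) : ℝ :=
  (A0 n m β - Real.sqrt ((A0 n m β) ^ 2 - 8 * ((n : ℝ) - 2 - n * m) * (1 - m))) / (2 * (1 - m))

def gamma2 (n : ℕ) (m β : ℝ) : ℝ :=
  (A0 n m β + Real.sqrt ((A0 n m β) ^ 2 - 8 * ((n : ℝ) - 2 - n * m) * (1 - m))) / (2 * (1 - m))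

def Acoef1 (n : ℕ) (m β : ℝ) : ℝ := 1 / (1 - m) - β * gamma1 n m β

def Acoef2 (n : ℕ) (m β : ℝ) : ℝ := 1 / (1 - m) - β * gamma2 n m β

/-- Condition (C1). -/
def CondC1 (n : ℕ) (m β : ℝ) : Prop :=
  beta1 n m < β ∨
    (4 < n ∧ 0 < m ∧ m < ((n : ℝ) - 4) / ((n : ℝ) - 2) ∧ beta0 n m < β ∧ β ≤ beta1 n m)

/-- Condition (C2). -/
def CondC2 (n : ℕ) (m β : ℝ) : Prop :=
  beta0 n m < β ∧ β < beta1 n m ∧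
    (n ≤ 4 ∨ (4 < n ∧ ((n : ℝ) - 4) / ((n : ℝ) - 2) < m ∧ m < ((n : ℝ) - 2) / n))

/-- Condition (C3). -/
def CondC3 (n : ℕ) (m β : ℝ) : Prop :=
  β = beta1 n m ∧
    (n ≤ 4 ∨ (4 < n ∧ ((n : ℝ) - 4) / ((n : ℝ) - 2) < m ∧ m < ((n : ℝ) - 2) / n))

/-- A self-similar profile `f = f_lam`. -/
structure IsProfile (n : ℕ) (m β α lam : ℝ) (f : ℝ → ℝ) : Prop where
  pos : ∀ r, 0 ≤ r → 0 < f r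
  smooth : ContDiffOn ℝ 2 f (Set.Ici 0)
  ode : ∀ r, 0 < r →
    deriv (deriv (fun s => f s ^ m)) r + (((n : ℝ) - 1) / r) * deriv (fun s => f s ^ m) r +
      α * f r + β * r * deriv f r = 0
  init : f 0 = lam ^ (2 / (1 - m))
  init' : deriv f 0 = 0
  asymp : Tendsto (fun r => r ^ 2 * f r ^ (1 - m)) atTop (nhds (Cstar n m))

/-- The Laplacian of `f : ℝ^n → ℝ`. -/
def lap (n : ℕ) (f : EuclideanSpace ℝ (Fin n) → ℝ) (x : EuclideanSpace ℝ (Fin n)) : ℝ :=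
  ∑ i : Fin n,
    fderiv ℝ (fun y => fderiv ℝ f y (EuclideanSpace.single i (1 : ℝ))) x
      (EuclideanSpace.single i (1 : ℝ))

/-- The self-similar solution `U_lam(x,t) = (T-t)^α f_lam((T-t)^β |x|)`. -/
def Uself (n : ℕ) (β α T : ℝ) (f : ℝ → ℝ) (x : EuclideanSpace ℝ (Fin n)) (t : ℝ) : ℝ :=
  (T - t) ^ α * f ((T - t) ^ β * ‖x‖)

/-- A (positive smooth) solution of the Cauchy problem `u_t = Δ(u^m)` on `ℝ^n × (0,T)` with
initial value `u0` taken in `L¹_loc`. -/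
structure IsCauchySolution (n : ℕ) (m T : ℝ) (u0 : EuclideanSpace ℝ (Fin n) → ℝ)
    (u : EuclideanSpace ℝ (Fin n) → ℝ → ℝ) : Prop where
  pos : ∀ x, ∀ t ∈ Set.Ioo 0 T, 0 < u x t
  smooth : ContDiffOn ℝ (⊤ : ℕ∞) (fun p : EuclideanSpace ℝ (Fin n) × ℝ => u p.1 p.2)
    ((Set.univ : Set (EuclideanSpace ℝ (Fin n))) ×ˢ Set.Ioo 0 T)
  pde : ∀ x, ∀ t ∈ Set.Ioo 0 T, deriv (u x) t = lap n (fun y => u y t ^ m) x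
  init : ∀ K : Set (EuclideanSpace ℝ (Fin n)), IsCompact K →
    Tendsto (fun t => ∫ x in K, |u x t - u0 x|) (nhdsWithin 0 (Set.Ioi 0)) (nhds 0)

/-- The rescaled solution `ũ(y,τ)`. -/
def resc (n : ℕ) (β α T : ℝ) (u : EuclideanSpace ℝ (Fin n) → ℝ → ℝ)
    (y : EuclideanSpace ℝ (Fin n)) (τ : ℝ) : ℝ :=
  (T * Real.exp (-τ)) ^ (-α) * u (((T * Real.exp (-τ)) ^ (-β)) • y) (T * (1 - Real.exp (-τ)))

/-- The singular profile `𝒞(y) = (C_*/|y|²)^{1/(1-m)}`. -/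
def singC (n : ℕ) (m : ℝ) (y : EuclideanSpace ℝ (Fin n)) : ℝ :=
  (Cstar n m / ‖y‖ ^ 2) ^ (1 / (1 - m))

/-- The weight exponent `p₀`. -/
def pZero (n : ℕ) (m β : ℝ) : ℝ := ((1 - m) / 2) * ((n : ℝ) - 2 / (1 - m) - gamma1 n m β)

/-- The constant `a_*`. -/
def aStar (n : ℕ) (m β : ℝ) : ℝ :=
  2 * m * pZero n m β / (Cstar n m * (1 - m)) * (gamma1 n m β + 2 * m / (1 - m))

/-- `Φ(s) = (1+w(s))^{1/m} − 1 − w(s)/m`. -/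
def Phi (m : ℝ) (w : ℝ → ℝ) (s : ℝ) : ℝ := (1 + w s) ^ (1 / m) - 1 - w s / m

end

/-- A positive solution of `u_t = Δ(u^m)` on the exterior region
`(ℝ^n \ B_{R₁}) × [0,T₁]`, of class `C^{2,1}` in the interior. -/
structure IsExteriorSolution (n : ℕ) (m R1 T1 : ℝ)
    (u : EuclideanSpace ℝ (Fin n) → ℝ → ℝ) : Prop where
  pos : ∀ x : EuclideanSpace ℝ (Fin n), R1 ≤ ‖x‖ → ∀ t ∈ Set.Icc 0 T1, 0 < u x t
  cont : ContinuousOn (fun p : EuclideanSpace ℝ (Fin n) × ℝ => u p.1 p.2)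
    ({x : EuclideanSpace ℝ (Fin n) | R1 ≤ ‖x‖} ×ˢ Set.Icc 0 T1)
  smoothSpace : ∀ t ∈ Set.Ioc 0 T1,
    ContDiffOn ℝ 2 (fun x => u x t) {x : EuclideanSpace ℝ (Fin n) | R1 < ‖x‖}
  smoothTime : ∀ x : EuclideanSpace ℝ (Fin n), R1 < ‖x‖ →
    ContDiffOn ℝ 1 (u x) (Set.Ioc 0 T1)
  pde : ∀ x : EuclideanSpace ℝ (Fin n), R1 < ‖x‖ → ∀ t ∈ Set.Ioc 0 T1,
    deriv (u x) t = lap n (fun y => u y t ^ m) x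

/-- Sum over the coordinate directions of the second differences of `f` at `x` with step `h`. -/
noncomputable def secondDiff {n : ℕ} (f : EuclideanSpace ℝ (Fin n) → ℝ) (h : ℝ)
    (x : EuclideanSpace ℝ (Fin n)) : ℝ :=
  ∑ i : Fin n, (f (x + h • EuclideanSpace.single i (1 : ℝ)) +
    f (x - h • EuclideanSpace.single i (1 : ℝ)) - 2 * f x)

/-- The second derivative of `f` at `x` in the `i`-th coordinate direction. -/
noncomputable def secondPartial {n : ℕ} (f : EuclideanSpace ℝ (Fin n) → ℝ) (i : Fin n)
    (x : EuclideanSpace ℝ (Fin n)) : ℝ :=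
  fderiv ℝ (fun y => fderiv ℝ f y (EuclideanSpace.single i (1 : ℝ))) x
    (EuclideanSpace.single i (1 : ℝ))

theorem exists_symm_second_difference_eq {f f' f'' : ℝ → ℝ} {h : ℝ} (hh : 0 < h)
    (hf : ∀ s, |s| ≤ h → HasDerivAt f (f' s) s)
    (hf' : ∀ s, |s| ≤ h → HasDerivAt f' (f'' s) s) :
    ∃ ξ, |ξ| ≤ h ∧ f h + f (-h) - 2 * f 0 = h ^ 2 * f'' ξ := by
  have hneg : ∀ g g' : ℝ → ℝ, (∀ s, |s| ≤ h → HasDerivAt g (g' s) s) → ∀ s, |s| ≤ h →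
      HasDerivAt (fun s => g (-s)) (-g' (-s)) s := by
    intro g g' hg s hs
    have := (hg (-s) (by rwa [abs_neg])).comp s (hasDerivAt_neg s)
    simpa [Function.comp_def] using this
  have h1 : ∀ s, |s| ≤ h → HasDerivAt (fun s => f s + f (-s)) (f' s - f' (-s)) s := by
    intro s hs
    simpa [sub_eq_add_neg] using (hf s hs).fun_add (hneg f f' hf s hs)
  have hI : ∀ s ∈ Icc 0 h, |s| ≤ h := fun s hs => by rw [abs_of_nonneg hs.1]; exact hs.2
  obtain ⟨c, hc, hc'⟩ := exists_ratio_hasDerivAt_eq_ratio_slope (fun s => f s + f (-s))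
    (fun s => f' s - f' (-s)) hh
    (fun s hs => (h1 s (hI s hs)).continuousAt.continuousWithinAt)
    (fun s hs => h1 s (hI s (Ioo_subset_Icc_self hs))) (fun s => s ^ 2) (fun s => 2 * s)
    (by fun_prop) (fun s _ => by simpa using hasDerivAt_pow 2 s)
  have hcI : ∀ s ∈ Icc (-c) c, |s| ≤ h := fun s hs =>
    abs_le.2 ⟨by linarith [hs.1, hc.2], by linarith [hs.2, hc.2]⟩
  obtain ⟨ξ, hξ, hξ'⟩ := exists_hasDerivAt_eq_slope f' f'' (a := -c) (b := c)
    (by linarith [hc.1])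
    (fun s hs => (hf' s (hcI s hs)).continuousAt.continuousWithinAt)
    (fun s hs => hf' s (hcI s (Ioo_subset_Icc_self hs)))
  refine ⟨ξ, hcI ξ (Ioo_subset_Icc_self hξ), ?_⟩
  have hc0 := hc.1
  rw [eq_div_iff (by linarith)] at hξ'
  simp only [neg_zero] at hc'
  have : (f h + f (-h) - 2 * f 0) * (2 * c) = (h ^ 2 * f'' ξ) * (2 * c) := by
    linear_combination -hc' - h ^ 2 * hξ'
  exact mul_right_cancel₀ (by linarith) this

theorem secondPartial_continuousOn {n : ℕ} {f : EuclideanSpace ℝ (Fin n) → ℝ}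
    {U : Set (EuclideanSpace ℝ (Fin n))} (hU : IsOpen U) (hf : ContDiffOn ℝ 2 f U) (i : Fin n) :
    ContinuousOn (secondPartial f i) U := by
  have h1 : ContDiffOn ℝ 1 (fun y => fderiv ℝ f y (EuclideanSpace.single i (1 : ℝ))) U :=
    (hf.fderiv_of_isOpen hU (by norm_num)).clm_apply contDiffOn_const
  exact (h1.continuousOn_fderiv_of_isOpen hU le_rfl).clm_apply continuousOn_const

theorem lap_continuousOn {n : ℕ} {f : EuclideanSpace ℝ (Fin n) → ℝ}
    {U : Set (EuclideanSpace ℝ (Fin n))} (hU : IsOpen U) (hf : ContDiffOn ℝ 2 f U) :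
    ContinuousOn (lap n f) U :=
  continuousOn_finsetSum _ fun i _ => secondPartial_continuousOn hU hf i

theorem norm_smul_single {n : ℕ} (i : Fin n) (s : ℝ) :
    ‖s • EuclideanSpace.single i (1 : ℝ)‖ = |s| := by
  rw [norm_smul]; simp

theorem exists_second_difference_eq {n : ℕ} {f : EuclideanSpace ℝ (Fin n) → ℝ}
    {U : Set (EuclideanSpace ℝ (Fin n))} (hU : IsOpen U) (hf : ContDiffOn ℝ 2 f U) (i : Fin n)
    {x : EuclideanSpace ℝ (Fin n)} {h : ℝ} (hh : 0 < h) (hx : Metric.closedBall x h ⊆ U) :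
    ∃ y ∈ Metric.closedBall x h, f (x + h • EuclideanSpace.single i (1 : ℝ)) +
      f (x - h • EuclideanSpace.single i (1 : ℝ)) - 2 * f x = h ^ 2 * secondPartial f i y := by
  set e := EuclideanSpace.single i (1 : ℝ) with he
  have hmem : ∀ s, |s| ≤ h → x + s • e ∈ Metric.closedBall x h := by
    intro s hs
    rw [Metric.mem_closedBall, dist_eq_norm, add_sub_cancel_left, he, norm_smul_single]
    exact hs
  have hline : ∀ s, HasDerivAt (fun s : ℝ => x + s • e) e s := fun s => by
    simpa using ((hasDerivAt_id s).smul_const e).const_add x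
  have h1 : ContDiffOn ℝ 1 (fun y => fderiv ℝ f y e) U :=
    (hf.fderiv_of_isOpen hU (by norm_num)).clm_apply contDiffOn_const
  obtain ⟨ξ, hξ, hξ'⟩ := exists_symm_second_difference_eq (f := fun s => f (x + s • e))
    (f' := fun s => fderiv ℝ f (x + s • e) e) (f'' := fun s => secondPartial f i (x + s • e)) hh
    (fun s hs => ((hf.differentiableOn (by norm_num)).differentiableAt
      (hU.mem_nhds (hx (hmem s hs)))).hasFDerivAt.comp_hasDerivAt s (hline s))
    (fun s hs => HasFDerivAt.comp_hasDerivAt (l := fun y => fderiv ℝ f y e) s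
      ((h1.differentiableOn (by norm_num)).differentiableAt
        (hU.mem_nhds (hx (hmem s hs)))).hasFDerivAt (hline s))
  refine ⟨_, hmem ξ hξ, ?_⟩
  simpa [sub_eq_add_neg] using hξ'

theorem tendsto_secondDiff {n : ℕ} {f : EuclideanSpace ℝ (Fin n) → ℝ}
    {U : Set (EuclideanSpace ℝ (Fin n))} (hU : IsOpen U) (hf : ContDiffOn ℝ 2 f U)
    {x : EuclideanSpace ℝ (Fin n)} (hx : x ∈ U) :
    Tendsto (fun h => secondDiff f h x / h ^ 2) (𝓝[>] 0) (𝓝 (lap n f x)) := by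
  simp only [secondDiff, Finset.sum_div]
  refine tendsto_finsetSum _ fun i _ => ?_
  rw [Metric.tendsto_nhds]
  intro ε hε
  have hc : ContinuousAt (secondPartial f i) x :=
    (secondPartial_continuousOn hU hf i).continuousAt (hU.mem_nhds hx)
  obtain ⟨δ, hδ, hδ'⟩ := Metric.nhds_basis_closedBall.mem_iff.1
    (inter_mem (hU.mem_nhds hx) (hc.preimage_mem_nhds (Metric.ball_mem_nhds _ hε)))
  filter_upwards [Ioc_mem_nhdsGT hδ] with h hh
  have hsub : Metric.closedBall x h ⊆ Metric.closedBall x δ :=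
    Metric.closedBall_subset_closedBall hh.2
  obtain ⟨y, hy, hy'⟩ := exists_second_difference_eq hU hf i hh.1
    (fun z hz => (hδ' (hsub hz)).1)
  rw [hy', mul_div_cancel_left₀ _ (by have := hh.1; positivity)]
  exact (hδ' (hsub hy)).2

theorem exists_abs_secondDiff_le {n : ℕ} {f : EuclideanSpace ℝ (Fin n) → ℝ}
    {U K : Set (EuclideanSpace ℝ (Fin n))} (hU : IsOpen U) (hf : ContDiffOn ℝ 2 f U)
    (hK : IsCompact K) (hKU : K ⊆ U) :
    ∃ C h₀ : ℝ, 0 ≤ C ∧ 0 < h₀ ∧ ∀ x ∈ K, ∀ h, 0 < h → h ≤ h₀ →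
      |secondDiff f h x| ≤ C * h ^ 2 := by
  obtain ⟨δ, hδ, hδU⟩ := hK.exists_cthickening_subset_open hU hKU
  have hc : ContinuousOn (fun y => ∑ i, |secondPartial f i y|) U :=
    continuousOn_finsetSum _ fun i _ => (secondPartial_continuousOn hU hf i).abs
  obtain ⟨C, hC⟩ := (hK.cthickening (r := δ)).exists_bound_of_continuousOn (hc.mono hδU)
  refine ⟨n * |C|, δ, by positivity, hδ, fun x hx h hh hhδ => ?_⟩
  have hsub : Metric.closedBall x h ⊆ Metric.cthickening δ K :=
    (Metric.closedBall_subset_closedBall hhδ).trans (Metric.closedBall_subset_cthickening hx δ)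
  calc |secondDiff f h x| ≤ ∑ i : Fin n, |C| * h ^ 2 := by
        refine (Finset.abs_sum_le_sum_abs _ _).trans (Finset.sum_le_sum fun i _ => ?_)
        obtain ⟨y, hy, hy'⟩ := exists_second_difference_eq hU hf i hh (hsub.trans hδU)
        rw [hy', abs_mul, abs_of_nonneg (sq_nonneg h), mul_comm]
        refine mul_le_mul_of_nonneg_right ?_ (sq_nonneg h)
        calc |secondPartial f i y| ≤ ∑ i, |secondPartial f i y| :=
              Finset.single_le_sum (f := fun i => |secondPartial f i y|)
                (fun _ _ => abs_nonneg _) (Finset.mem_univ i)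
          _ ≤ |C| := (le_abs_self _).trans ((hC y (hsub hy)).trans (le_abs_self C))
    _ = n * |C| * h ^ 2 := by simp [mul_assoc]

theorem lap_le_of_secondDiff_le {n : ℕ} {f g : EuclideanSpace ℝ (Fin n) → ℝ}
    {U : Set (EuclideanSpace ℝ (Fin n))} (hU : IsOpen U) (hf : ContDiffOn ℝ 2 f U)
    (hg : ContDiffOn ℝ 2 g U) {x : EuclideanSpace ℝ (Fin n)} (hx : x ∈ U) {c : ℝ}
    (h : ∀ᶠ h in 𝓝[>] (0 : ℝ), secondDiff f h x ≤ secondDiff g h x + c * h ^ 2) :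
    lap n f x ≤ lap n g x + c := by
  refine le_of_tendsto_of_tendsto (tendsto_secondDiff hU hf hx)
    ((tendsto_secondDiff hU hg hx).add_const c) ?_
  filter_upwards [h, self_mem_nhdsWithin] with h hh hpos
  have hpos : 0 < h := hpos
  have : secondDiff g h x / h ^ 2 + c = (secondDiff g h x + c * h ^ 2) / h ^ 2 := by
    field_simp
  rw [this]
  gcongr

theorem secondDiff_sub {n : ℕ} (f g : EuclideanSpace ℝ (Fin n) → ℝ) (h : ℝ)
    (x : EuclideanSpace ℝ (Fin n)) :
    secondDiff (fun y => f y - g y) h x = secondDiff f h x - secondDiff g h x := by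
  simp only [secondDiff, ← Finset.sum_sub_distrib]
  exact Finset.sum_congr rfl fun i _ => by ring

theorem secondDiff_const_mul {n : ℕ} (c : ℝ) (f : EuclideanSpace ℝ (Fin n) → ℝ) (h : ℝ)
    (x : EuclideanSpace ℝ (Fin n)) :
    secondDiff (fun y => c * f y) h x = c * secondDiff f h x := by
  simp only [secondDiff, Finset.mul_sum]
  exact Finset.sum_congr rfl fun i _ => by ring

/-- Comparison of second differences at a point where `f - g` has a local maximum. -/
theorem secondDiff_le_of_isLocalMax {n : ℕ} {f g : EuclideanSpace ℝ (Fin n) → ℝ}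
    {x : EuclideanSpace ℝ (Fin n)} (hmax : ∀ᶠ y in 𝓝 x, f y - g y ≤ f x - g x) :
    ∀ᶠ h in 𝓝[>] (0 : ℝ), secondDiff f h x ≤ secondDiff g h x := by
  obtain ⟨δ, hδ, hδ'⟩ := Metric.nhds_basis_closedBall.mem_iff.1 hmax
  filter_upwards [Ioc_mem_nhdsGT hδ] with h hh
  refine Finset.sum_le_sum fun i _ => ?_
  have hn : ‖h • EuclideanSpace.single i (1 : ℝ)‖ ≤ δ := by
    rw [norm_smul_single, abs_of_pos hh.1]; exact hh.2
  have h1 : f (x + h • EuclideanSpace.single i (1 : ℝ)) -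
      g (x + h • EuclideanSpace.single i (1 : ℝ)) ≤ f x - g x :=
    hδ' (by simpa [Metric.mem_closedBall, dist_eq_norm] using hn)
  have h2 : f (x - h • EuclideanSpace.single i (1 : ℝ)) -
      g (x - h • EuclideanSpace.single i (1 : ℝ)) ≤ f x - g x :=
    hδ' (by simpa [Metric.mem_closedBall, dist_eq_norm] using hn)
  linarith

theorem norm_add_smul_single_sq {n : ℕ} (x : EuclideanSpace ℝ (Fin n)) (i : Fin n) (s : ℝ) :
    ‖x + s • EuclideanSpace.single i (1 : ℝ)‖ ^ 2 = ‖x‖ ^ 2 + 2 * s * x i + s ^ 2 := by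
  rw [norm_add_sq_real, norm_smul_single, sq_abs, inner_smul_right,
    EuclideanSpace.inner_single_right]
  simp; ring

theorem norm_sub_smul_single_sq {n : ℕ} (x : EuclideanSpace ℝ (Fin n)) (i : Fin n) (s : ℝ) :
    ‖x - s • EuclideanSpace.single i (1 : ℝ)‖ ^ 2 = ‖x‖ ^ 2 - 2 * s * x i + s ^ 2 := by
  have := norm_add_smul_single_sq x i (-s)
  rw [neg_smul, ← sub_eq_add_neg] at this
  rw [this]; ring

theorem secondDiff_norm_sub_sq {n : ℕ} (a : EuclideanSpace ℝ (Fin n)) (h : ℝ)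
    (x : EuclideanSpace ℝ (Fin n)) :
    secondDiff (fun y => ‖y - a‖ ^ 2) h x = 2 * n * h ^ 2 := by
  have : ∀ i : Fin n, ‖x + h • EuclideanSpace.single i (1 : ℝ) - a‖ ^ 2 +
      ‖x - h • EuclideanSpace.single i (1 : ℝ) - a‖ ^ 2 - 2 * ‖x - a‖ ^ 2 = 2 * h ^ 2 := by
    intro i
    rw [add_sub_right_comm x, sub_right_comm x, norm_add_smul_single_sq, norm_sub_smul_single_sq]
    ring
  simp only [secondDiff, this]
  simp; ring

theorem sum_sq_eq_norm_sq {n : ℕ} (x : EuclideanSpace ℝ (Fin n)) : ∑ i, x i ^ 2 = ‖x‖ ^ 2 := by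
  simp [EuclideanSpace.norm_sq_eq]

theorem two_add_sq_le_exp_add_exp_neg (y : ℝ) : 2 + y ^ 2 ≤ exp y + exp (-y) := by
  have h1 : exp y + exp (-y) = 2 * cosh y := by rw [Real.cosh_eq]; ring
  have h2 : cosh y = 2 * sinh (y / 2) ^ 2 + 1 := by
    have := Real.cosh_two_mul (y / 2)
    rw [mul_div_cancel₀ y two_ne_zero] at this
    rw [this, Real.cosh_sq]; ring
  have h3 : (y / 2) ^ 2 ≤ sinh (y / 2) ^ 2 := by
    rw [sq_le_sq, Real.abs_sinh]
    exact Real.self_le_sinh_iff.2 (abs_nonneg _)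
  rw [h1, h2]; nlinarith

/-- Lower bound for the second differences of the Gaussian `exp (-α ‖x‖²)`. -/
theorem le_secondDiff_gaussian {n : ℕ} {α h : ℝ}
    (x : EuclideanSpace ℝ (Fin n)) :
    exp (-α * ‖x‖ ^ 2) * (4 * α ^ 2 * ‖x‖ ^ 2 - 2 * n * α - 4 * α ^ 3 * h ^ 2 * ‖x‖ ^ 2) * h ^ 2 ≤
      secondDiff (fun y => exp (-α * ‖y‖ ^ 2)) h x := by
  have key : ∀ i : Fin n, exp (-α * ‖x‖ ^ 2) *
      (4 * α ^ 2 * x i ^ 2 - 2 * α - 4 * α ^ 3 * h ^ 2 * x i ^ 2) * h ^ 2 ≤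
      exp (-α * ‖x + h • EuclideanSpace.single i (1 : ℝ)‖ ^ 2) +
      exp (-α * ‖x - h • EuclideanSpace.single i (1 : ℝ)‖ ^ 2) - 2 * exp (-α * ‖x‖ ^ 2) := by
    intro i
    rw [norm_add_smul_single_sq, norm_sub_smul_single_sq]
    have e1 : exp (-α * (‖x‖ ^ 2 + 2 * h * x i + h ^ 2)) =
        exp (-α * ‖x‖ ^ 2) * (exp (-(α * h ^ 2)) * exp (-(2 * α * h * x i))) := by
      rw [← exp_add, ← exp_add]; congr 1; ring
    have e2 : exp (-α * (‖x‖ ^ 2 - 2 * h * x i + h ^ 2)) =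
        exp (-α * ‖x‖ ^ 2) * (exp (-(α * h ^ 2)) * exp (2 * α * h * x i)) := by
      rw [← exp_add, ← exp_add]; congr 1; ring
    have h1 := two_add_sq_le_exp_add_exp_neg (2 * α * h * x i)
    have h2 : 1 - α * h ^ 2 ≤ exp (-(α * h ^ 2)) := by
      have := add_one_le_exp (-(α * h ^ 2)); linarith
    have h3 : (1 - α * h ^ 2) * (2 + (2 * α * h * x i) ^ 2) ≤
        exp (-(α * h ^ 2)) * (exp (2 * α * h * x i) + exp (-(2 * α * h * x i))) :=
      mul_le_mul h2 h1 (by positivity) (exp_pos _).le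
    rw [e1, e2]
    have h4 := mul_le_mul_of_nonneg_left h3 (exp_pos (-α * ‖x‖ ^ 2)).le
    refine le_trans (le_of_eq ?_) (sub_le_sub_right (h4.trans (le_of_eq ?_)) _)
    · ring
    · ring
  refine le_trans (le_of_eq ?_) (Finset.sum_le_sum fun i _ => key i)
  simp only [← Finset.sum_mul, ← Finset.mul_sum, Finset.sum_sub_distrib, sum_sq_eq_norm_sq,
    Finset.sum_const, Finset.card_univ, Fintype.card_fin, nsmul_eq_mul]
  ring

theorem inv_sq_le_of_abs_le {ρ δ : ℝ} (hρ : 0 < ρ) (hδ : |δ| ≤ ρ / 2) :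
    ((ρ + δ) ^ 2)⁻¹ ≤ (ρ ^ 2)⁻¹ - 2 * δ * (ρ ^ 3)⁻¹ + 8 * δ ^ 2 * (ρ ^ 4)⁻¹ := by
  obtain ⟨y, rfl⟩ : ∃ y, δ = ρ * y := ⟨δ / ρ, by field_simp⟩
  rw [abs_mul, abs_of_pos hρ] at hδ
  have hy : |y| ≤ 1 / 2 := by
    by_contra hcon
    push Not at hcon
    nlinarith
  obtain ⟨hy1, hy2⟩ := abs_le.1 hy
  have hpos : 0 < ρ + ρ * y := by nlinarith
  have e : (ρ ^ 2)⁻¹ - 2 * (ρ * y) * (ρ ^ 3)⁻¹ + 8 * (ρ * y) ^ 2 * (ρ ^ 4)⁻¹ =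
      (1 - 2 * y + 8 * y ^ 2) / ρ ^ 2 := by
    field_simp
  rw [e, inv_eq_one_div, div_le_div_iff₀ (by positivity) (by positivity)]
  have : 1 ≤ (1 - 2 * y + 8 * y ^ 2) * (1 + y) ^ 2 := by
    nlinarith [mul_nonneg (sq_nonneg y) (by linarith : (0:ℝ) ≤ y + 1 / 2), sq_nonneg y,
      mul_nonneg (sq_nonneg y) (sq_nonneg (y + 1/2)), sq_nonneg (y^2)]
  nlinarith [sq_nonneg ρ]

/-- Upper bound for the second differences of `(r² - ‖x - a‖²)⁻²`. -/
theorem secondDiff_inv_sq_le {n : ℕ} (a : EuclideanSpace ℝ (Fin n)) {r : ℝ}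
    {x : EuclideanSpace ℝ (Fin n)} (hx : ‖x - a‖ < r) :
    ∀ᶠ h in 𝓝[>] (0 : ℝ),
      secondDiff (fun y => ((r ^ 2 - ‖y - a‖ ^ 2) ^ 2)⁻¹) h x ≤
        ((20 * n + 64) * r ^ 2 * ((r ^ 2 - ‖x - a‖ ^ 2) ^ 4)⁻¹) * h ^ 2 := by
  have hr : 0 < r := (norm_nonneg _).trans_lt hx
  set ρ := r ^ 2 - ‖x - a‖ ^ 2 with hρd
  have hρ : 0 < ρ := by
    have := pow_lt_pow_left₀ hx (norm_nonneg _) two_ne_zero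
    linarith
  have hρr : ρ ≤ r ^ 2 := by have := sq_nonneg ‖x - a‖; linarith
  have hη : 0 < min r (ρ / (6 * r)) := by positivity
  filter_upwards [Ioc_mem_nhdsGT hη] with h hh
  have hh0 := hh.1
  have hhr : h ≤ r := hh.2.trans (min_le_left _ _)
  have hhρ : 3 * r * h ≤ ρ / 2 := by
    have := hh.2.trans (min_le_right _ _)
    rw [le_div_iff₀ (by positivity)] at this
    linarith
  have hcoord : ∀ i, |(x - a) i| ≤ r := fun i =>
    (by simpa using PiLp.norm_apply_le (x - a) i : |(x - a) i| ≤ ‖x - a‖).trans hx.le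
  have key : ∀ i : Fin n,
      ((r ^ 2 - ‖x + h • EuclideanSpace.single i (1 : ℝ) - a‖ ^ 2) ^ 2)⁻¹ +
      ((r ^ 2 - ‖x - h • EuclideanSpace.single i (1 : ℝ) - a‖ ^ 2) ^ 2)⁻¹ -
      2 * (ρ ^ 2)⁻¹ ≤
      4 * h ^ 2 * (ρ ^ 3)⁻¹ + (64 * (x - a) i ^ 2 * h ^ 2 + 16 * h ^ 4) * (ρ ^ 4)⁻¹ := by
    intro i
    rw [add_sub_right_comm x, sub_right_comm x, norm_add_smul_single_sq, norm_sub_smul_single_sq]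
    obtain ⟨hc1, hc2⟩ := abs_le.1 (hcoord i)
    set b := (x - a) i
    have hb1 : h * b ≤ h * r := by gcongr
    have hb2 : -(h * r) ≤ h * b := by nlinarith
    have hhh : h ^ 2 ≤ h * r := by nlinarith
    have h1 := inv_sq_le_of_abs_le (δ := -(2 * h * b) - h ^ 2) hρ
      (abs_le.2 ⟨by nlinarith, by nlinarith⟩)
    have h2 := inv_sq_le_of_abs_le (δ := 2 * h * b - h ^ 2) hρ
      (abs_le.2 ⟨by nlinarith, by nlinarith⟩)
    have e1 : r ^ 2 - (‖x - a‖ ^ 2 + 2 * h * b + h ^ 2) = ρ + (-(2 * h * b) - h ^ 2) := by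
      rw [hρd]; ring
    have e2 : r ^ 2 - (‖x - a‖ ^ 2 - 2 * h * b + h ^ 2) = ρ + (2 * h * b - h ^ 2) := by
      rw [hρd]; ring
    rw [e1, e2]
    refine (sub_le_sub_right (add_le_add h1 h2) _).trans (le_of_eq ?_)
    ring
  refine (Finset.sum_le_sum fun i _ => key i).trans ?_
  simp only [Finset.sum_add_distrib, ← Finset.sum_mul, ← Finset.mul_sum, sum_sq_eq_norm_sq,
    Finset.sum_const, Finset.card_univ, Fintype.card_fin, nsmul_eq_mul]
  have e3 : (ρ ^ 3)⁻¹ = ρ * (ρ ^ 4)⁻¹ := by field_simp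
  have h4 : 0 ≤ (ρ ^ 4)⁻¹ := by positivity
  rw [e3]
  have hx2 : ‖x - a‖ ^ 2 ≤ r ^ 2 := by linarith
  have hh2 : h ^ 2 ≤ r ^ 2 := by gcongr
  have hn : (0 : ℝ) ≤ n := Nat.cast_nonneg n
  have : 4 * n * h ^ 2 * ρ + (64 * ‖x - a‖ ^ 2 * h ^ 2 + n * (16 * h ^ 4)) ≤
      (20 * n + 64) * r ^ 2 * h ^ 2 := by
    have a1 : 4 * n * h ^ 2 * ρ ≤ 4 * n * h ^ 2 * r ^ 2 := by gcongr
    have a2 : 64 * ‖x - a‖ ^ 2 * h ^ 2 ≤ 64 * r ^ 2 * h ^ 2 := by gcongr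
    have a3 : n * (16 * h ^ 4) ≤ n * (16 * (h ^ 2 * r ^ 2)) := by
      have : h ^ 4 = h ^ 2 * h ^ 2 := by ring
      rw [this]; gcongr
    linarith
  have := mul_le_mul_of_nonneg_right this h4
  linarith

theorem rpow_le_tangent {p x y : ℝ} (hp0 : 0 ≤ p) (hp1 : p ≤ 1) (hx : 0 < x) (hy : 0 < y) :
    x ^ p ≤ y ^ p + p * y ^ (p - 1) * (x - y) := by
  have h := rpow_one_add_le_one_add_mul_self (s := (x - y) / y)
    (by rw [le_div_iff₀ hy]; linarith) hp0 hp1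
  have e : 1 + (x - y) / y = x / y := by field_simp; ring
  rw [e, div_rpow hx.le hy.le, div_le_iff₀ (by positivity)] at h
  rw [rpow_sub_one hy.ne']
  refine h.trans (le_of_eq ?_)
  field_simp

theorem mul_sub_le_rpow_sub_rpow {p x y M : ℝ} (hp0 : 0 ≤ p) (hp1 : p ≤ 1) (hy : 0 < y)
    (hyx : y ≤ x) (hxM : x ≤ M) : p * M ^ (p - 1) * (x - y) ≤ x ^ p - y ^ p := by
  have hx := hy.trans_le hyx
  have h := rpow_le_tangent hp0 hp1 hy hx
  have h2 : M ^ (p - 1) ≤ x ^ (p - 1) := rpow_le_rpow_of_nonpos hx hxM (by linarith)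
  have : p * M ^ (p - 1) * (x - y) ≤ p * x ^ (p - 1) * (x - y) := by
    have : 0 ≤ x - y := by linarith
    gcongr
  linarith

theorem rpow_sub_rpow_le_mul_sub {p x y c : ℝ} (hp0 : 0 ≤ p) (hp1 : p ≤ 1) (hc : 0 < c)
    (hcy : c ≤ y) (hyx : y ≤ x) : x ^ p - y ^ p ≤ p * c ^ (p - 1) * (x - y) := by
  have hy := hc.trans_le hcy
  have h := rpow_le_tangent hp0 hp1 (hy.trans_le hyx) hy
  have h2 : y ^ (p - 1) ≤ c ^ (p - 1) := rpow_le_rpow_of_nonpos hc hcy (by linarith)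
  have : p * y ^ (p - 1) * (x - y) ≤ p * c ^ (p - 1) * (x - y) := by
    have : 0 ≤ x - y := by linarith
    gcongr
  linarith

theorem nonneg_of_hasDerivAt_of_left_max {f : ℝ → ℝ} {f' a b : ℝ} (hab : a < b)
    (hf : HasDerivAt f f' b) (hmax : ∀ s ∈ Ioo a b, f s ≤ f b) : 0 ≤ f' := by
  have h := (hasDerivAt_iff_tendsto_slope_left_right.1 hf).1
  refine ge_of_tendsto h ?_
  filter_upwards [Ioo_mem_nhdsLT hab] with s hs
  rw [slope_def_field]
  exact div_nonneg_of_nonpos (by linarith [hmax s hs]) (by linarith [hs.2])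

theorem isOpen_exterior (n : ℕ) (R : ℝ) : IsOpen {x : EuclideanSpace ℝ (Fin n) | R < ‖x‖} :=
  isOpen_lt continuous_const continuous_norm

theorem exterior_mem_nhds {n : ℕ} {R : ℝ} {x : EuclideanSpace ℝ (Fin n)} (hx : R < ‖x‖) :
    {x : EuclideanSpace ℝ (Fin n) | R < ‖x‖} ∈ 𝓝 x :=
  (isOpen_exterior n R).mem_nhds hx

namespace IsExteriorSolution

variable {n : ℕ} {m R1 T1 : ℝ} {u : EuclideanSpace ℝ (Fin n) → ℝ → ℝ}

theorem hasDerivAt (hu : IsExteriorSolution n m R1 T1 u) {x : EuclideanSpace ℝ (Fin n)}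
    (hx : R1 < ‖x‖) {t : ℝ} (ht : t ∈ Ioo 0 T1) :
    HasDerivAt (u x) (lap n (fun y => u y t ^ m) x) t := by
  rw [← hu.pde x hx t (Ioo_subset_Ioc_self ht)]
  exact (((hu.smoothTime x hx).differentiableOn one_ne_zero t
    (Ioo_subset_Ioc_self ht)).differentiableAt (Ioc_mem_nhds ht.1 ht.2)).hasDerivAt

theorem hasDerivAt_rpow (hu : IsExteriorSolution n m R1 T1 u) {x : EuclideanSpace ℝ (Fin n)}
    (hx : R1 < ‖x‖) {t : ℝ} (ht : t ∈ Ioo 0 T1) :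
    HasDerivAt (fun s => u x s ^ m)
      (m * u x t ^ (m - 1) * lap n (fun y => u y t ^ m) x) t := by
  convert (hu.hasDerivAt hx ht).rpow_const (p := m)
    (Or.inl (hu.pos x hx.le t (Ioo_subset_Icc_self ht)).ne') using 1
  ring

theorem contDiffOn_rpow (hu : IsExteriorSolution n m R1 T1 u) {t : ℝ} (ht : t ∈ Ioc 0 T1) :
    ContDiffOn ℝ 2 (fun y => u y t ^ m) {x : EuclideanSpace ℝ (Fin n) | R1 < ‖x‖} :=
  (hu.smoothSpace t ht).rpow_const_of_ne fun x hx =>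
    (hu.pos x (le_of_lt hx) t (Ioc_subset_Icc_self ht)).ne'

theorem continuousOn_rpow (hu : IsExteriorSolution n m R1 T1 u) :
    ContinuousOn (fun p : EuclideanSpace ℝ (Fin n) × ℝ => u p.1 p.2 ^ m)
      ({x : EuclideanSpace ℝ (Fin n) | R1 ≤ ‖x‖} ×ˢ Icc 0 T1) :=
  hu.cont.rpow_const fun p hp => Or.inl (hu.pos p.1 hp.1 p.2 hp.2).ne'

theorem continuousOn_time (hu : IsExteriorSolution n m R1 T1 u) {x : EuclideanSpace ℝ (Fin n)}
    (hx : R1 ≤ ‖x‖) : ContinuousOn (u x) (Icc 0 T1) :=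
  hu.cont.comp (f := fun t => (x, t)) (by fun_prop) fun _ ht => ⟨hx, ht⟩

theorem exists_bounds (hu : IsExteriorSolution n m R1 T1 u)
    {K : Set (EuclideanSpace ℝ (Fin n))} (hK : IsCompact K)
    (hKR : K ⊆ {x : EuclideanSpace ℝ (Fin n) | R1 ≤ ‖x‖}) :
    ∃ c M : ℝ, 0 < c ∧ 0 < M ∧ ∀ x ∈ K, ∀ t ∈ Icc 0 T1, c ≤ u x t ∧ u x t ≤ M := by
  have hcomp : IsCompact (K ×ˢ Icc 0 T1) := hK.prod isCompact_Icc
  have hcont := hu.cont.mono (prod_mono hKR (subset_refl (Icc 0 T1)))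
  obtain ⟨M, hM⟩ := hcomp.exists_bound_of_continuousOn hcont
  rcases (K ×ˢ Icc 0 T1).eq_empty_or_nonempty with h | hne
  · refine ⟨1, 1, one_pos, one_pos, fun x hx t ht => ?_⟩
    have : (x, t) ∈ K ×ˢ Icc 0 T1 := ⟨hx, ht⟩
    simp [h] at this
  · obtain ⟨p, hp, hpmin⟩ := hcomp.exists_isMinOn hne hcont
    refine ⟨u p.1 p.2, max M 1, hu.pos _ (hKR hp.1) _ hp.2, by positivity, fun x hx t ht => ?_⟩
    exact ⟨hpmin (a := (x, t)) ⟨hx, ht⟩,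
      le_trans (le_trans (le_abs_self _) (hM (x, t) ⟨hx, ht⟩)) (le_max_left _ _)⟩

end IsExteriorSolution

theorem lap_const_mul {n : ℕ} {f : EuclideanSpace ℝ (Fin n) → ℝ}
    {U : Set (EuclideanSpace ℝ (Fin n))} (hU : IsOpen U) (hf : ContDiffOn ℝ 2 f U)
    {x : EuclideanSpace ℝ (Fin n)} (hx : x ∈ U) (c : ℝ) :
    lap n (fun y => c * f y) x = c * lap n f x := by
  refine tendsto_nhds_unique (tendsto_secondDiff hU (contDiffOn_const.mul hf) hx) ?_
  simpa only [secondDiff_const_mul, mul_div_assoc] using (tendsto_secondDiff hU hf hx).const_mul c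

theorem secondDiff_add {n : ℕ} (f g : EuclideanSpace ℝ (Fin n) → ℝ) (h : ℝ)
    (x : EuclideanSpace ℝ (Fin n)) :
    secondDiff (fun y => f y + g y) h x = secondDiff f h x + secondDiff g h x := by
  simp only [secondDiff, ← Finset.sum_add_distrib]
  exact Finset.sum_congr rfl fun i _ => by ring

namespace IsExteriorSolution

variable {n : ℕ} {m R1 T1 : ℝ} {u : EuclideanSpace ℝ (Fin n) → ℝ → ℝ}

theorem rpow_sub_le_of_barrier (hu : IsExteriorSolution n m R1 T1 u) (hm0 : 0 < m)
    {x₀ : EuclideanSpace ℝ (Fin n)} {r t T' L S Λ σ : ℝ} (hr : 0 < r)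
    (hball : Metric.closedBall x₀ r ⊆ {x | R1 < ‖x‖}) (ht : 0 < t) (hT' : T' < T1)
    (hL : ∀ x ∈ Metric.closedBall x₀ r, |lap n (fun y => u y t ^ m) x| ≤ L)
    (hS : ∀ x ∈ Metric.closedBall x₀ r, ∀ s ∈ Icc t T', u x s ^ m ≤ S)
    (hΛ : ∀ x ∈ Metric.closedBall x₀ r, ∀ s ∈ Icc t T', m * u x s ^ (m - 1) ≤ Λ)
    (hσ : σ = 1 ∨ σ = -1) {s₀ : ℝ} (hs₀ : s₀ ∈ Icc t T') :
    σ * (u x₀ s₀ ^ m - u x₀ t ^ m) ≤ (Λ * (L + 2 * n * (S / r ^ 2)) + 1) * (s₀ - t) := by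
  have hx₀ : x₀ ∈ Metric.closedBall x₀ r := Metric.mem_closedBall_self hr.le
  have htt : t ∈ Icc t T' := ⟨le_rfl, hs₀.1.trans hs₀.2⟩
  have hpos : ∀ x ∈ Metric.closedBall x₀ r, ∀ s ∈ Icc t T', 0 < u x s := fun x hx s hs =>
    hu.pos x (le_of_lt (hball hx)) s ⟨by linarith [hs.1], by linarith [hs.2]⟩
  have hL0 : 0 ≤ L := (abs_nonneg _).trans (hL _ hx₀)
  have hS0 : 0 ≤ S := (rpow_nonneg (hpos _ hx₀ _ htt).le m).trans (hS _ hx₀ _ htt)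
  have hΛ0 : 0 ≤ Λ := le_trans (mul_nonneg hm0.le (rpow_nonneg (hpos _ hx₀ _ htt).le _))
    (hΛ _ hx₀ _ htt)
  set B := S / r ^ 2 with hB
  have hB0 : 0 ≤ B := by positivity
  set A := Λ * (L + 2 * n * B) + 1 with hA
  have hA0 : 0 < A := by positivity
  by_contra! hcon
  let g : EuclideanSpace ℝ (Fin n) × ℝ → ℝ := fun p =>
    σ * (u p.1 p.2 ^ m - u p.1 t ^ m) - A * (p.2 - t) - B * ‖p.1 - x₀‖ ^ 2
  have hsub : Metric.closedBall x₀ r ×ˢ Icc t T' ⊆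
      {x : EuclideanSpace ℝ (Fin n) | R1 ≤ ‖x‖} ×ˢ Icc 0 T1 := by
    rintro ⟨x, s⟩ ⟨hx, hs⟩
    exact ⟨(show R1 < ‖x‖ from hball hx).le, by linarith [hs.1], by linarith [hs.2]⟩
  have hFt : ContinuousOn (fun p : EuclideanSpace ℝ (Fin n) × ℝ => u p.1 t ^ m)
      (Metric.closedBall x₀ r ×ˢ Icc t T') :=
    hu.continuousOn_rpow.comp (f := fun p : EuclideanSpace ℝ (Fin n) × ℝ => (p.1, t))
      (by fun_prop) fun p hp => hsub ⟨hp.1, htt⟩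
  have hg : ContinuousOn g (Metric.closedBall x₀ r ×ˢ Icc t T') := by
    have := hu.continuousOn_rpow.mono hsub
    fun_prop
  obtain ⟨⟨x₁, s₁⟩, ⟨hx₁, hs₁⟩, hmax⟩ :=
    ((isCompact_closedBall x₀ r).prod isCompact_Icc).exists_isMaxOn ⟨(x₀, s₀), hx₀, hs₀⟩ hg
  replace hmax : ∀ x ∈ Metric.closedBall x₀ r, ∀ s ∈ Icc t T', g (x, s) ≤ g (x₁, s₁) :=
    fun x hx s hs => hmax (a := (x, s)) ⟨hx, hs⟩
  have hgpos : 0 < g (x₁, s₁) := by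
    refine lt_of_lt_of_le ?_ (hmax _ hx₀ _ hs₀)
    simp only [g, sub_self, norm_zero]
    linarith
  dsimp only at hx₁ hs₁
  have hs₁t : t < s₁ := by
    rcases hs₁.1.eq_or_lt with h | h
    · exfalso
      simp only [g, ← h, sub_self, mul_zero, zero_sub] at hgpos
      nlinarith [sq_nonneg ‖x₁ - x₀‖]
    · exact h
  have hFle : σ * (u x₁ s₁ ^ m - u x₁ t ^ m) ≤ S := by
    have h1 := hS _ hx₁ _ hs₁
    have h2 := hS _ hx₁ _ htt
    have h3 := rpow_nonneg (hpos _ hx₁ _ hs₁).le m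
    have h4 := rpow_nonneg (hpos _ hx₁ _ htt).le m
    rcases hσ with rfl | rfl <;> linarith
  have hx₁r : ‖x₁ - x₀‖ < r := by
    by_contra! h
    have h1 : S ≤ B * ‖x₁ - x₀‖ ^ 2 := by
      rw [hB, div_mul_eq_mul_div, le_div_iff₀ (by positivity)]
      gcongr
    simp only [g] at hgpos
    nlinarith [mul_pos hA0 (sub_pos.2 hs₁t)]
  have hx₁U := hball hx₁
  have hs₁I : s₁ ∈ Ioo 0 T1 := ⟨by linarith, by linarith [hs₁.2]⟩
  have hder : HasDerivAt (fun s => g (x₁, s))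
      (σ * (m * u x₁ s₁ ^ (m - 1) * lap n (fun y => u y s₁ ^ m) x₁) - A) s₁ := by
    have h1 := (((hu.hasDerivAt_rpow hx₁U hs₁I).sub_const (u x₁ t ^ m)).const_mul σ).fun_sub
      (((hasDerivAt_id s₁).sub_const t).const_mul A)
    have h2 := h1.sub_const (B * ‖x₁ - x₀‖ ^ 2)
    simpa [g] using h2
  have htime := nonneg_of_hasDerivAt_of_left_max hs₁t hder fun s hs =>
    hmax _ hx₁ _ ⟨hs.1.le, hs.2.le.trans hs₁.2⟩
  have hC : ∀ s ∈ Ioc 0 T1, ContDiffOn ℝ 2 (fun y => σ * u y s ^ m)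
      {x : EuclideanSpace ℝ (Fin n) | R1 < ‖x‖} := fun s hs =>
    contDiffOn_const.mul (hu.contDiffOn_rpow hs)
  have htI : t ∈ Ioc 0 T1 := ⟨ht, by linarith [hs₀.1, hs₀.2]⟩
  have hspace := lap_le_of_secondDiff_le (isOpen_exterior n R1)
    (hC s₁ (Ioo_subset_Ioc_self hs₁I)) (hC t htI) hx₁U (c := 2 * n * B) <| by
    have hloc : ∀ᶠ y in 𝓝 x₁, σ * u y s₁ ^ m - (σ * u y t ^ m + B * ‖y - x₀‖ ^ 2) ≤
        σ * u x₁ s₁ ^ m - (σ * u x₁ t ^ m + B * ‖x₁ - x₀‖ ^ 2) := by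
      filter_upwards [Metric.isOpen_ball.mem_nhds (mem_ball_iff_norm.2 hx₁r)] with y hy
      have := hmax y (Metric.ball_subset_closedBall hy) s₁ hs₁
      simp only [g] at this
      linarith
    filter_upwards [secondDiff_le_of_isLocalMax hloc] with h hh
    rw [secondDiff_add, secondDiff_const_mul B, secondDiff_norm_sub_sq] at hh
    linarith
  rw [lap_const_mul (isOpen_exterior n R1) (hu.contDiffOn_rpow (Ioo_subset_Ioc_self hs₁I)) hx₁U,
    lap_const_mul (isOpen_exterior n R1) (hu.contDiffOn_rpow htI) hx₁U] at hspace
  have hlapt : σ * lap n (fun y => u y t ^ m) x₁ ≤ L := by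
    have := abs_le.1 (hL _ hx₁)
    rcases hσ with rfl | rfl <;> linarith
  have hk0 : 0 ≤ m * u x₁ s₁ ^ (m - 1) := mul_nonneg hm0.le (rpow_nonneg (hpos _ hx₁ _ hs₁).le _)
  have hk1 := hΛ _ hx₁ _ hs₁
  have h1 : m * u x₁ s₁ ^ (m - 1) * (σ * lap n (fun y => u y s₁ ^ m) x₁) ≤
      m * u x₁ s₁ ^ (m - 1) * (L + 2 * n * B) :=
    mul_le_mul_of_nonneg_left (by linarith) hk0
  have h2 : m * u x₁ s₁ ^ (m - 1) * (L + 2 * n * B) ≤ Λ * (L + 2 * n * B) :=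
    mul_le_mul_of_nonneg_right hk1 (by positivity)
  nlinarith

theorem exists_forward_lipschitz (hu : IsExteriorSolution n m R1 T1 u) (hm0 : 0 < m) (hm1 : m < 1)
    {K : Set (EuclideanSpace ℝ (Fin n))} (hK : IsCompact K)
    (hKR : K ⊆ {x : EuclideanSpace ℝ (Fin n) | R1 < ‖x‖}) {t T' : ℝ} (ht : 0 < t)
    (hT' : T' < T1) :
    ∃ C : ℝ, 0 ≤ C ∧ ∀ x ∈ K, ∀ s ∈ Icc t T', |u x s - u x t| ≤ C * (s - t) := by
  rcases lt_or_ge T' t with hlt | htT'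
  · exact ⟨0, le_rfl, fun x _ s hs => absurd (hs.1.trans hs.2) (not_le.2 hlt)⟩
  obtain ⟨r, hr, hrU⟩ := hK.exists_cthickening_subset_open (isOpen_exterior n R1) hKR
  have hK' : IsCompact (Metric.cthickening r K) := hK.cthickening
  obtain ⟨c, M, hc, hM, hcM⟩ := hu.exists_bounds hK' fun x hx => (show R1 < ‖x‖ from hrU hx).le
  have htI : t ∈ Ioc 0 T1 := ⟨ht, htT'.trans hT'.le⟩
  obtain ⟨L, hL⟩ := hK'.exists_bound_of_continuousOn
    ((lap_continuousOn (isOpen_exterior n R1) (hu.contDiffOn_rpow htI)).mono hrU)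
  set A := m * c ^ (m - 1) * (L + 2 * n * (M ^ m / r ^ 2)) + 1 with hA
  have hI : ∀ s ∈ Icc t T', s ∈ Icc 0 T1 := fun s hs => ⟨by linarith [hs.1], by linarith [hs.2]⟩
  have key : ∀ σ : ℝ, σ = 1 ∨ σ = -1 → ∀ x ∈ K, ∀ s ∈ Icc t T',
      σ * (u x s ^ m - u x t ^ m) ≤ A * (s - t) := fun σ hσ x hx s hs => by
    have hsub := Metric.closedBall_subset_cthickening hx r
    refine hu.rpow_sub_le_of_barrier hm0 hr (hsub.trans hrU) ht hT'
      (fun y hy => hL y (hsub hy)) (fun y hy s hs => ?_) (fun y hy s hs => ?_) hσ hs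
    · have := hcM y (hsub hy) s (hI s hs)
      exact rpow_le_rpow (hc.le.trans this.1) this.2 hm0.le
    · have := hcM y (hsub hy) s (hI s hs)
      exact mul_le_mul_of_nonneg_left
        (rpow_le_rpow_of_nonpos hc this.1 (by linarith)) hm0.le
  have hd : 0 < m * M ^ (m - 1) := by positivity
  have habs : ∀ x ∈ K, ∀ s ∈ Icc t T', |u x s - u x t| ≤ A / (m * M ^ (m - 1)) * (s - t) := by
    intro x hx s hs
    have hxK := Metric.self_subset_cthickening K (δ := r) hx
    have h1 := hcM x hxK s (hI s hs)
    have h2 := hcM x hxK t (hI t ⟨le_rfl, htT'⟩)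
    have k1 := key 1 (Or.inl rfl) x hx s hs
    have k2 := key (-1) (Or.inr rfl) x hx s hs
    rw [div_mul_eq_mul_div, le_div_iff₀ hd]
    rcases le_total (u x t) (u x s) with h | h
    · rw [abs_of_nonneg (by linarith)]
      have := mul_sub_le_rpow_sub_rpow hm0.le hm1.le (hc.trans_le h2.1) h h1.2
      linarith
    · rw [abs_of_nonpos (by linarith)]
      have := mul_sub_le_rpow_sub_rpow hm0.le hm1.le (hc.trans_le h1.1) h h2.2
      linarith
  refine ⟨max (A / (m * M ^ (m - 1))) 0, le_max_right _ _, fun x hx s hs =>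
    (habs x hx s hs).trans ?_⟩
  exact mul_le_mul_of_nonneg_right (le_max_left _ _) (by linarith [hs.1])

end IsExteriorSolution

theorem nonpos_of_hasDerivAt_of_right_max {f : ℝ → ℝ} {f' a b : ℝ} (hab : a < b)
    (hf : HasDerivAt f f' a) (hmax : ∀ s ∈ Ioo a b, f s ≤ f a) : f' ≤ 0 := by
  have h1 : HasDerivAt (fun s => f (2 * a - s)) (-f') a :=
    HasDerivAt.comp_const_sub (2 * a) a (by rwa [two_mul, add_sub_cancel_right])
  have := nonneg_of_hasDerivAt_of_left_max (a := 2 * a - b) (by linarith) h1 fun s hs => by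
    rw [two_mul, add_sub_cancel_right]
    exact hmax _ ⟨by linarith [hs.2], by linarith [hs.1]⟩
  linarith

namespace IsExteriorSolution

variable {n : ℕ} {m R1 T1 : ℝ} {u : EuclideanSpace ℝ (Fin n) → ℝ → ℝ}

set_option maxHeartbeats 1000000 in
theorem weighted_rpow_sub_le (hu : IsExteriorSolution n m R1 T1 u) (hm0 : 0 < m) (hm1 : m < 1)
    {x₀ : EuclideanSpace ℝ (Fin n)} {r c M c₀ A : ℝ} (hr : 0 < r) (hc : 0 < c) (hM : 0 < M)
    (hc₀ : c₀ = (1 - m) * M ^ (1 - m - 1) / m / (m * c ^ (m - 1)))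
    (hA : A = (r ^ 4 * (M ^ (1 - m) / m) + T1 * ((20 * n + 64) * r ^ 2)) / c₀ + 1)
    (hball : Metric.closedBall x₀ r ⊆ {x | R1 < ‖x‖})
    (hcM : ∀ x ∈ Metric.closedBall x₀ r, ∀ t ∈ Icc 0 T1, c ≤ u x t ∧ u x t ≤ M)
    {t₀ t s : ℝ} (ht₀ : 0 < t₀) (ht : t₀ ≤ t) (hts : t ≤ s) (hs : s < T1) :
    (t - t₀) * r ^ 4 * (u x₀ s ^ m - u x₀ t ^ m) ≤ A * (s - t) := by
  have hx₀ : x₀ ∈ Metric.closedBall x₀ r := Metric.mem_closedBall_self hr.le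
  have hT1 : 0 < T1 := by linarith
  have hc₀pos : 0 < c₀ := by
    have : 0 < 1 - m := by linarith
    rw [hc₀]; positivity
  have hA0 : 0 < A := by rw [hA]; positivity
  by_contra! hcon
  let q : EuclideanSpace ℝ (Fin n) → ℝ := fun x => (r ^ 2 - ‖x - x₀‖ ^ 2) ^ 2
  let g : EuclideanSpace ℝ (Fin n) × ℝ × ℝ → ℝ := fun p =>
    (p.2.1 - t₀) * q p.1 * (u p.1 p.2.2 ^ m - u p.1 p.2.1 ^ m) - A * (p.2.2 - p.2.1)
  let Q : Set (EuclideanSpace ℝ (Fin n) × ℝ × ℝ) :=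
    (Metric.closedBall x₀ r ×ˢ (Icc t₀ s ×ˢ Icc t₀ s)) ∩ {p | p.2.1 ≤ p.2.2}
  have hQ : IsCompact Q :=
    ((isCompact_closedBall x₀ r).prod (isCompact_Icc.prod isCompact_Icc)).inter_right
      (isClosed_le (by fun_prop) (by fun_prop))
  have hI : ∀ τ ∈ Icc t₀ s, τ ∈ Icc 0 T1 := fun τ hτ =>
    ⟨by linarith [hτ.1], by linarith [hτ.2]⟩
  have hF2 : ContinuousOn (fun p : EuclideanSpace ℝ (Fin n) × ℝ × ℝ => u p.1 p.2.2 ^ m) Q :=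
    hu.continuousOn_rpow.comp (f := fun p : EuclideanSpace ℝ (Fin n) × ℝ × ℝ => (p.1, p.2.2))
      (by fun_prop) fun p hp =>
        ⟨(show R1 < ‖p.1‖ from hball hp.1.1).le, hI _ hp.1.2.2⟩
  have hF1 : ContinuousOn (fun p : EuclideanSpace ℝ (Fin n) × ℝ × ℝ => u p.1 p.2.1 ^ m) Q :=
    hu.continuousOn_rpow.comp (f := fun p : EuclideanSpace ℝ (Fin n) × ℝ × ℝ => (p.1, p.2.1))
      (by fun_prop) fun p hp =>
        ⟨(show R1 < ‖p.1‖ from hball hp.1.1).le, hI _ hp.1.2.1⟩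
  have hg : ContinuousOn g Q := by fun_prop
  have hmem : (x₀, t, s) ∈ Q := ⟨⟨hx₀, ⟨ht, hts⟩, ht.trans hts, le_rfl⟩, hts⟩
  obtain ⟨⟨x₁, t₁, s₁⟩, ⟨⟨hx₁, ht₁, hs₁⟩, hts₁⟩, hmax⟩ := hQ.exists_isMaxOn ⟨_, hmem⟩ hg
  dsimp only at hx₁ ht₁ hs₁
  replace hts₁ : t₁ ≤ s₁ := hts₁
  replace hmax : ∀ x ∈ Metric.closedBall x₀ r, ∀ τ ∈ Icc t₀ s, ∀ σ ∈ Icc t₀ s, τ ≤ σ →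
      g (x, τ, σ) ≤ g (x₁, t₁, s₁) := fun x hx τ hτ σ hσ h =>
    hmax (a := (x, τ, σ)) ⟨⟨hx, hτ, hσ⟩, h⟩
  have hgpos : 0 < g (x₁, t₁, s₁) := by
    refine lt_of_lt_of_le ?_ (hmax _ hx₀ _ ⟨ht, hts⟩ _ ⟨ht.trans hts, le_rfl⟩ hts)
    simp only [g, q, sub_self, norm_zero]
    ring_nf at hcon ⊢
    linarith
  set E := u x₁ s₁ ^ m - u x₁ t₁ ^ m with hE
  have hgE : g (x₁, t₁, s₁) = (t₁ - t₀) * q x₁ * E - A * (s₁ - t₁) := rfl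
  have hq0 : 0 ≤ q x₁ := sq_nonneg _
  have hDE : 0 < (t₁ - t₀) * q x₁ * E := by nlinarith
  have ht₁' : t₀ < t₁ := by
    refine lt_of_le_of_ne ht₁.1 fun h => ?_
    simp [h] at hDE
  have hqpos : 0 < q x₁ := by
    refine lt_of_le_of_ne hq0 fun h => ?_
    simp [← h] at hDE
  have hEpos : 0 < E := by
    have : 0 < (t₁ - t₀) * q x₁ := mul_pos (by linarith) hqpos
    exact (pos_iff_pos_of_mul_pos hDE).1 this
  have hts₁' : t₁ < s₁ := by
    refine lt_of_le_of_ne hts₁ fun h => ?_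
    simp [hE, h] at hEpos
  have hx₁le : ‖x₁ - x₀‖ ≤ r := mem_closedBall_iff_norm.1 hx₁
  have hx₁r : ‖x₁ - x₀‖ < r := by
    refine lt_of_le_of_ne hx₁le fun h => ?_
    simp [q, h] at hqpos
  have hx₁U := hball hx₁
  have hs₁I : s₁ ∈ Ioo 0 T1 := ⟨by linarith, by linarith [hs₁.2]⟩
  have ht₁I : t₁ ∈ Ioo 0 T1 := ⟨by linarith, by linarith [hs₁.2]⟩
  set as := lap n (fun y => u y s₁ ^ m) x₁ with has
  set at' := lap n (fun y => u y t₁ ^ m) x₁ with hat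
  -- the derivative in the later time
  have hder_s : HasDerivAt (fun σ => g (x₁, t₁, σ))
      ((t₁ - t₀) * q x₁ * (m * u x₁ s₁ ^ (m - 1) * as) - A) s₁ := by
    have h1 := (((hu.hasDerivAt_rpow hx₁U hs₁I).sub_const (u x₁ t₁ ^ m)).const_mul
      ((t₁ - t₀) * q x₁)).fun_sub (((hasDerivAt_id s₁).sub_const t₁).const_mul A)
    simpa [g] using h1
  have htime_s := nonneg_of_hasDerivAt_of_left_max hts₁' hder_s fun σ hσ =>
    hmax _ hx₁ _ ht₁ _ ⟨ht₁.1.trans hσ.1.le, hσ.2.le.trans hs₁.2⟩ hσ.1.le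
  -- the derivative in the earlier time
  have hder_t : HasDerivAt (fun τ => g (x₁, τ, s₁))
      (q x₁ * E - (t₁ - t₀) * q x₁ * (m * u x₁ t₁ ^ (m - 1) * at') + A) t₁ := by
    have h1 := ((((hasDerivAt_id t₁).sub_const t₀).mul_const (q x₁)).fun_mul
      ((hu.hasDerivAt_rpow hx₁U ht₁I).const_sub (u x₁ s₁ ^ m))).fun_sub
      (((hasDerivAt_id t₁).const_sub s₁).const_mul A)
    refine HasDerivAt.congr_deriv (f := fun τ => g (x₁, τ, s₁)) h1 ?_
    simp only [id, hE, hat]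
    ring
  have htime_t := nonneg_of_hasDerivAt_of_left_max ht₁' hder_t fun τ hτ =>
    hmax _ hx₁ _ ⟨hτ.1.le, hτ.2.le.trans ht₁.2⟩ _ hs₁ (hτ.2.le.trans hts₁)
  -- the Laplacian
  set ρ := r ^ 2 - ‖x₁ - x₀‖ ^ 2 with hρ
  have hqρ : q x₁ = ρ ^ 2 := rfl
  have hρ0 : 0 < ρ := sub_pos.2 (pow_lt_pow_left₀ hx₁r (norm_nonneg _) two_ne_zero)
  have hspace : as ≤ at' + E * q x₁ * ((20 * n + 64) * r ^ 2 * (ρ ^ 4)⁻¹) := by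
    refine lap_le_of_secondDiff_le (isOpen_exterior n R1)
      (hu.contDiffOn_rpow (Ioo_subset_Ioc_self hs₁I))
      (hu.contDiffOn_rpow (Ioo_subset_Ioc_self ht₁I)) hx₁U ?_
    have hloc : ∀ᶠ y in 𝓝 x₁,
        (u y s₁ ^ m - u y t₁ ^ m) - E * q x₁ * (q y)⁻¹ ≤
        (u x₁ s₁ ^ m - u x₁ t₁ ^ m) - E * q x₁ * (q x₁)⁻¹ := by
      filter_upwards [Metric.isOpen_ball.mem_nhds (mem_ball_iff_norm.2 hx₁r)] with y hy
      have hyq : 0 < q y := by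
        have h1 := mem_ball_iff_norm.1 hy
        have h2 := norm_nonneg (y - x₀)
        exact pow_pos (sub_pos.2 (pow_lt_pow_left₀ h1 h2 two_ne_zero)) 2
      have h1 := hmax y (Metric.ball_subset_closedBall hy) _ ht₁ _ hs₁ hts₁
      rw [hgE] at h1
      simp only [g] at h1
      have h2 : (t₁ - t₀) * (q y * (u y s₁ ^ m - u y t₁ ^ m)) ≤ (t₁ - t₀) * (E * q x₁) := by
        linarith
      have h3 := le_of_mul_le_mul_left h2 (sub_pos.2 ht₁')
      rw [mul_inv_cancel_right₀ hqpos.ne', ← hE, sub_self, sub_nonpos, ← div_eq_mul_inv,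
        le_div_iff₀ hyq]
      linarith
    filter_upwards [secondDiff_le_of_isLocalMax hloc, secondDiff_inv_sq_le x₀ hx₁r] with h hh hh2
    rw [secondDiff_sub, secondDiff_const_mul (E * q x₁) fun y => (q y)⁻¹] at hh
    have h3 := mul_le_mul_of_nonneg_left hh2 (mul_pos hEpos hqpos).le
    simp only [q] at hh h3 ⊢
    linarith
  -- conclusion
  have bs := hcM _ hx₁ _ (Ioo_subset_Icc_self hs₁I)
  have bt := hcM _ hx₁ _ (Ioo_subset_Icc_self ht₁I)
  have us0 : 0 < u x₁ s₁ := hc.trans_le bs.1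
  have ut0 : 0 < u x₁ t₁ := hc.trans_le bt.1
  have hinv : ∀ v : ℝ, 0 < v → v ^ (1 - m) / m * (m * v ^ (m - 1)) = 1 := fun v hv => by
    have : v ^ (1 - m) * v ^ (m - 1) = 1 := by
      rw [← rpow_add hv]; simp
    field_simp
    linarith
  have hD : 0 < (t₁ - t₀) * q x₁ := mul_pos (by linarith) hqpos
  have e1 : A * (u x₁ s₁ ^ (1 - m) / m) ≤ (t₁ - t₀) * q x₁ * as := by
    have h1 : 0 < u x₁ s₁ ^ (1 - m) / m := by positivity
    have h2 := mul_nonneg h1.le htime_s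
    have h3 := hinv _ us0
    linear_combination h2 + (t₁ - t₀) * q x₁ * as * h3
  have e2 : (t₁ - t₀) * q x₁ * at' ≤ (A + q x₁ * E) * (u x₁ t₁ ^ (1 - m) / m) := by
    have h1 : 0 < u x₁ t₁ ^ (1 - m) / m := by positivity
    have h2 := mul_nonneg h1.le htime_t
    have h3 := hinv _ ut0
    linear_combination h2 - (t₁ - t₀) * q x₁ * at' * h3
  have e3 : (t₁ - t₀) * q x₁ * as ≤ (t₁ - t₀) * q x₁ * at' +
      E * ((t₁ - t₀) * ((20 * n + 64) * r ^ 2)) := by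
    have h1 := mul_le_mul_of_nonneg_left hspace hD.le
    have h2 : (t₁ - t₀) * q x₁ * (E * q x₁ * ((20 * n + 64) * r ^ 2 * (ρ ^ 4)⁻¹)) =
        E * ((t₁ - t₀) * ((20 * n + 64) * r ^ 2)) := by
      rw [hqρ]; field_simp
    linarith
  have e4 : E * ((t₁ - t₀) * ((20 * n + 64) * r ^ 2)) ≤ E * (T1 * ((20 * n + 64) * r ^ 2)) := by
    gcongr
    linarith [ht₁I.2]
  have hutus : u x₁ t₁ ≤ u x₁ s₁ := by
    by_contra! h
    have := rpow_le_rpow us0.le h.le hm0.le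
    linarith
  have e5 : q x₁ * E * (u x₁ t₁ ^ (1 - m) / m) ≤ E * (r ^ 4 * (M ^ (1 - m) / m)) := by
    have h1 : q x₁ ≤ r ^ 4 := by
      have : ρ ≤ r ^ 2 := sub_le_self _ (sq_nonneg _)
      linear_combination pow_le_pow_left₀ hρ0.le this 2 + hqρ
    have h2 : u x₁ t₁ ^ (1 - m) ≤ M ^ (1 - m) := rpow_le_rpow ut0.le bt.2 (by linarith)
    calc q x₁ * E * (u x₁ t₁ ^ (1 - m) / m) = E * (q x₁ * (u x₁ t₁ ^ (1 - m) / m)) := by ring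
      _ ≤ E * (r ^ 4 * (M ^ (1 - m) / m)) := by gcongr
  have e6 : c₀ * E ≤ u x₁ s₁ ^ (1 - m) / m - u x₁ t₁ ^ (1 - m) / m := by
    have h1 := mul_sub_le_rpow_sub_rpow (p := 1 - m) (by linarith) (by linarith) ut0 hutus bs.2
    have h2 := rpow_sub_rpow_le_mul_sub hm0.le hm1.le hc bt.1 hutus
    have h3 : 0 < m * c ^ (m - 1) := by positivity
    rw [hc₀, ← sub_div, div_mul_eq_mul_div, div_le_iff₀ h3, div_mul_eq_mul_div, div_mul_eq_mul_div]
    refine div_le_div_of_nonneg_right ?_ hm0.le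
    have h4 : 0 ≤ (1 - m) * M ^ (1 - m - 1) := mul_nonneg (by linarith) (by positivity)
    linear_combination mul_le_mul_of_nonneg_left h2 h4 + mul_le_mul_of_nonneg_right h1 h3.le
  have e7 := mul_le_mul_of_nonneg_left e6 hA0.le
  have e8 : A * c₀ = r ^ 4 * (M ^ (1 - m) / m) + T1 * ((20 * n + 64) * r ^ 2) + c₀ := by
    rw [hA]; field_simp
  have e9 : A * (c₀ * E) = E * (r ^ 4 * (M ^ (1 - m) / m)) +
      E * (T1 * ((20 * n + 64) * r ^ 2)) + c₀ * E := by
    linear_combination E * e8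
  have e10 : c₀ * E ≤ 0 := by linear_combination e1 + e2 + e3 + e4 + e5 + e7 - e9
  exact absurd (mul_pos hc₀pos hEpos) (not_lt.2 e10)

/-- A local one-sided bound of Aronson–Bénilan type. -/
theorem exists_lap_le (hu : IsExteriorSolution n m R1 T1 u) (hm0 : 0 < m) (hm1 : m < 1)
    {K : Set (EuclideanSpace ℝ (Fin n))} (hK : IsCompact K)
    (hKR : K ⊆ {x : EuclideanSpace ℝ (Fin n) | R1 < ‖x‖}) {ta : ℝ} (hta : 0 < ta) :
    ∃ C : ℝ, 0 ≤ C ∧ ∀ x ∈ K, ∀ t ∈ Ico ta T1, lap n (fun y => u y t ^ m) x ≤ C := by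
  rcases le_or_gt T1 ta with hle | htaT
  · exact ⟨0, le_rfl, fun x _ t ht => absurd (ht.1.trans_lt ht.2) (not_lt.2 hle)⟩
  have hT1 : 0 < T1 := hta.trans htaT
  obtain ⟨r, hr, hrU⟩ := hK.exists_cthickening_subset_open (isOpen_exterior n R1) hKR
  obtain ⟨c, M, hc, hM, hcM⟩ := hu.exists_bounds (hK.cthickening (r := r))
    fun x hx => (show R1 < ‖x‖ from hrU hx).le
  obtain ⟨c₀, hc₀⟩ : ∃ c₀, c₀ = (1 - m) * M ^ (1 - m - 1) / m / (m * c ^ (m - 1)) := ⟨_, rfl⟩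
  obtain ⟨A, hA⟩ : ∃ A, A =
    (r ^ 4 * (M ^ (1 - m) / m) + T1 * ((20 * n + 64) * r ^ 2)) / c₀ + 1 := ⟨_, rfl⟩
  have hA0 : 0 < A := by
    have : 0 < 1 - m := by linarith
    have : 0 < c₀ := by rw [hc₀]; positivity
    rw [hA]; positivity
  have hw : 0 < ta / 2 * r ^ 4 := by positivity
  have hd : 0 < m * M ^ (m - 1) := by positivity
  refine ⟨A / (ta / 2 * r ^ 4) / (m * M ^ (m - 1)), by positivity, fun x hx t ht => ?_⟩
  have hsub := Metric.closedBall_subset_cthickening hx r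
  have htI : t ∈ Ioo 0 T1 := ⟨hta.trans_le ht.1, ht.2⟩
  have hslope : ∀ s ∈ Ioo t T1, u x s ^ m - A / (ta / 2 * r ^ 4) * s ≤
      u x t ^ m - A / (ta / 2 * r ^ 4) * t := by
    intro s hs
    have h1 := hu.weighted_rpow_sub_le hm0 hm1 hr hc hM hc₀ hA (hsub.trans hrU)
      (fun y hy => hcM y (hsub hy)) (half_pos hta) (by linarith [ht.1]) hs.1.le hs.2
    suffices u x s ^ m - u x t ^ m ≤ A / (ta / 2 * r ^ 4) * (s - t) by linarith
    rw [div_mul_eq_mul_div, le_div_iff₀ hw]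
    rcases le_total (u x s ^ m - u x t ^ m) 0 with h | h
    · nlinarith [mul_nonneg hA0.le (sub_nonneg.2 hs.1.le)]
    · have : ta / 2 * r ^ 4 ≤ (t - ta / 2) * r ^ 4 := by
        gcongr
        linarith [ht.1]
      nlinarith
  have hder := nonpos_of_hasDerivAt_of_right_max ht.2 ((hu.hasDerivAt_rpow (hKR hx) htI).fun_sub
    ((hasDerivAt_id t).const_mul (A / (ta / 2 * r ^ 4)))) hslope
  rw [le_div_iff₀ hd]
  have hb := hcM x (Metric.self_subset_cthickening K hx) t (Ioo_subset_Icc_self htI)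
  have hk : m * M ^ (m - 1) ≤ m * u x t ^ (m - 1) :=
    mul_le_mul_of_nonneg_left (rpow_le_rpow_of_nonpos (hc.trans_le hb.1) hb.2 (by linarith)) hm0.le
  have hA' : 0 < A / (ta / 2 * r ^ 4) := by positivity
  rcases le_total (lap n (fun y => u y t ^ m) x) 0 with h | h
  · nlinarith
  · nlinarith

end IsExteriorSolution

theorem isCompact_shell (n : ℕ) (a b : ℝ) :
    IsCompact {x : EuclideanSpace ℝ (Fin n) | a ≤ ‖x‖ ∧ ‖x‖ ≤ b} := by
  refine (isCompact_closedBall (0 : EuclideanSpace ℝ (Fin n)) b).of_isClosed_subset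
    ((isClosed_le continuous_const continuous_norm).inter
      (isClosed_le continuous_norm continuous_const)) fun x hx => ?_
  simpa using hx.2

theorem rpow_sub_one_sub_le {m c M x y : ℝ} (hm0 : 0 < m) (hm1 : m < 1) (hc : 0 < c)
    (hcx : c ≤ x) (hxy : x ≤ y) (hyM : y ≤ M) :
    m * x ^ (m - 1) - m * y ^ (m - 1) ≤ M / c ^ 2 * (y ^ m - x ^ m) := by
  have hx := hc.trans_le hcx
  have hy := hx.trans_le hxy
  have hM := hy.trans_le hyM
  have e1 := mul_sub_le_rpow_sub_rpow hm0.le hm1.le hx hxy hyM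
  rw [rpow_sub_one hx.ne', rpow_sub_one hy.ne']
  rw [rpow_sub_one hM.ne'] at e1
  have hxM : x ^ m ≤ M ^ m := rpow_le_rpow hx.le (hxy.trans hyM) hm0.le
  have hxy' : x ^ m ≤ y ^ m := rpow_le_rpow hx.le hxy hm0.le
  calc m * (x ^ m / x) - m * (y ^ m / y) ≤ m * (x ^ m / x) - m * (x ^ m / y) := by gcongr
    _ = m * x ^ m * (y - x) / (x * y) := by field_simp
    _ ≤ m * M ^ m * (y - x) / (c * c) := by
        have := sub_nonneg.2 hxy
        gcongr
        exact hcx.trans hxy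
    _ = M / c ^ 2 * (m * (M ^ m / M) * (y - x)) := by field_simp
    _ ≤ M / c ^ 2 * (y ^ m - x ^ m) := by gcongr

namespace IsExteriorSolution

variable {n : ℕ} {m R1 T1 : ℝ} {u1 u2 : EuclideanSpace ℝ (Fin n) → ℝ → ℝ}

/-- Strict ordering on the inner boundary persists in a boundary layer. -/
theorem exists_layer (h1 : IsExteriorSolution n m R1 T1 u1) (h2 : IsExteriorSolution n m R1 T1 u2)
    (hbdry : ∀ x : EuclideanSpace ℝ (Fin n), ‖x‖ = R1 → ∀ t ∈ Ioc 0 T1, u1 x t < u2 x t)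
    {ta ρ₀ : ℝ} (hta : 0 < ta) (hρ₀ : R1 < ρ₀) :
    ∃ ρ, R1 < ρ ∧ ρ < ρ₀ ∧ ∀ x : EuclideanSpace ℝ (Fin n), R1 ≤ ‖x‖ → ‖x‖ ≤ ρ →
      ∀ t ∈ Icc ta T1, u1 x t < u2 x t := by
  set K := {x : EuclideanSpace ℝ (Fin n) | R1 ≤ ‖x‖ ∧ ‖x‖ ≤ ρ₀} ×ˢ Icc ta T1 with hKdef
  have hK : IsCompact K := (isCompact_shell n R1 ρ₀).prod isCompact_Icc
  have hsub : K ⊆ {x : EuclideanSpace ℝ (Fin n) | R1 ≤ ‖x‖} ×ˢ Icc 0 T1 := fun p hp =>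
    ⟨hp.1.1, hta.le.trans hp.2.1, hp.2.2⟩
  have hbad : IsCompact (K ∩ (fun p : EuclideanSpace ℝ (Fin n) × ℝ =>
      u1 p.1 p.2 - u2 p.1 p.2) ⁻¹' Ici 0) :=
    hK.of_isClosed_subset (((h1.cont.mono hsub).sub (h2.cont.mono hsub)).preimage_isClosed_of_isClosed
      hK.isClosed isClosed_Ici) inter_subset_left
  have hstep : ∀ ρ' : ℝ, R1 < ρ' → ρ' ≤ ρ₀ → (∀ p ∈ (K ∩ (fun p : EuclideanSpace ℝ (Fin n) × ℝ =>
      u1 p.1 p.2 - u2 p.1 p.2) ⁻¹' Ici 0), ρ' ≤ ‖p.1‖) → ∃ ρ, R1 < ρ ∧ ρ < ρ₀ ∧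
      ∀ x : EuclideanSpace ℝ (Fin n), R1 ≤ ‖x‖ → ‖x‖ ≤ ρ → ∀ t ∈ Icc ta T1, u1 x t < u2 x t := by
    intro ρ' hρ' hρ'₀ h
    refine ⟨(R1 + ρ') / 2, by linarith, by linarith, fun x hx hxρ t ht => ?_⟩
    by_contra! hcon
    have := h (x, t) ⟨⟨⟨hx, by linarith⟩, ht⟩, sub_nonneg.2 hcon⟩
    dsimp only at this
    linarith
  rcases (K ∩ (fun p : EuclideanSpace ℝ (Fin n) × ℝ =>
      u1 p.1 p.2 - u2 p.1 p.2) ⁻¹' Ici 0).eq_empty_or_nonempty with he | hne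
  · exact hstep ρ₀ hρ₀ le_rfl fun p hp => by simp [he] at hp
  · obtain ⟨p, hp, hpmin⟩ := hbad.exists_isMinOn hne
      (f := fun p : EuclideanSpace ℝ (Fin n) × ℝ => ‖p.1‖) (by fun_prop)
    refine hstep ‖p.1‖ ?_ hp.1.1.2 fun q hq => hpmin hq
    refine lt_of_le_of_ne hp.1.1.1 fun h => ?_
    have h3 := hbdry p.1 h.symm p.2 ⟨hta.trans_le hp.1.2.1, hp.1.2.2⟩
    have h4 : 0 ≤ u1 p.1 p.2 - u2 p.1 p.2 := hp.2
    linarith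

theorem gaussian_barrier_le (h1 : IsExteriorSolution n m R1 T1 u1)
    (h2 : IsExteriorSolution n m R1 T1 u2) (hm0 : 0 < m) (hm1 : m < 1)
    {ρ R0 ta t' α β ε κ₀ C c M : ℝ} (hρ0 : 0 < ρ) (hρ : R1 < ρ) (hta : 0 < ta) (htT : t' < T1)
    (hc : 0 < c) (hC : 0 ≤ C) (hε : 0 < ε) (hκ₀ : 0 ≤ κ₀) (hα0 : 0 < α)
    (hcM1 : ∀ x, ρ ≤ ‖x‖ → ‖x‖ ≤ R0 → ∀ t ∈ Icc 0 T1, c ≤ u1 x t ∧ u1 x t ≤ M)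
    (hcM2 : ∀ x, ρ ≤ ‖x‖ → ‖x‖ ≤ R0 → ∀ t ∈ Icc 0 T1, c ≤ u2 x t ∧ u2 x t ≤ M)
    (hAB : ∀ x, ρ ≤ ‖x‖ → ‖x‖ ≤ R0 → ∀ t ∈ Ico ta T1, lap n (fun y => u1 y t ^ m) x ≤ C)
    (hweak : ∀ x, ρ ≤ ‖x‖ → ‖x‖ ≤ R0 → ∀ t ∈ Icc ta t', u1 x t ≤ u2 x t)
    (hφa : ∀ x : EuclideanSpace ℝ (Fin n), ρ ≤ ‖x‖ → ‖x‖ ≤ R0 →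
      exp (α * β * ta) * exp (-α * ‖x‖ ^ 2) ≤ κ₀)
    (hφR : ∀ x : EuclideanSpace ℝ (Fin n), ‖x‖ = R0 → ∀ t ∈ Icc ta t',
      exp (α * β * t) * exp (-α * ‖x‖ ^ 2) ≤ κ₀)
    (hφρ : ∀ x, ‖x‖ = ρ → ∀ t ∈ Icc ta t',
      ε * (exp (α * β * t) * exp (-α * ‖x‖ ^ 2) - κ₀) ≤ u2 x t ^ m - u1 x t ^ m)
    (hαn : 2 * n ≤ α * ρ ^ 2)
    (hα : α * β + M / c ^ 2 * C < 2 * (m * M ^ (m - 1)) * ρ ^ 2 * α ^ 2) :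
    ∀ x, ρ ≤ ‖x‖ → ‖x‖ ≤ R0 → ∀ t ∈ Icc ta t',
      ε * (exp (α * β * t) * exp (-α * ‖x‖ ^ 2) - κ₀) ≤ u2 x t ^ m - u1 x t ^ m := by
  intro x₀ hx₀ρ hx₀R s₀ hs₀
  by_contra! hcon
  let g : EuclideanSpace ℝ (Fin n) × ℝ → ℝ := fun p => u1 p.1 p.2 ^ m - u2 p.1 p.2 ^ m +
    ε * (exp (α * β * p.2) * exp (-α * ‖p.1‖ ^ 2) - κ₀)
  set K := {x : EuclideanSpace ℝ (Fin n) | ρ ≤ ‖x‖ ∧ ‖x‖ ≤ R0} with hK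
  have hsub : K ×ˢ Icc ta t' ⊆ {x : EuclideanSpace ℝ (Fin n) | R1 ≤ ‖x‖} ×ˢ Icc 0 T1 :=
    fun p hp => ⟨hρ.le.trans hp.1.1, hta.le.trans hp.2.1, hp.2.2.trans htT.le⟩
  have hg : ContinuousOn g (K ×ˢ Icc ta t') := by
    have := h1.continuousOn_rpow.mono hsub
    have := h2.continuousOn_rpow.mono hsub
    fun_prop
  obtain ⟨⟨x, t⟩, ⟨⟨hxρ, hxR⟩, ht⟩, hmax⟩ := ((isCompact_shell n ρ R0).prod
    isCompact_Icc).exists_isMaxOn ⟨(x₀, s₀), ⟨hx₀ρ, hx₀R⟩, hs₀⟩ hg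
  dsimp only at hxρ hxR ht
  replace hmax : ∀ y, ρ ≤ ‖y‖ → ‖y‖ ≤ R0 → ∀ s ∈ Icc ta t', g (y, s) ≤ g (x, t) :=
    fun y hy hy' s hs => hmax (a := (y, s)) ⟨⟨hy, hy'⟩, hs⟩
  have hgpos : 0 < g (x, t) := by
    refine lt_of_lt_of_le ?_ (hmax _ hx₀ρ hx₀R _ hs₀)
    simp only [g]
    linarith
  have hg0 : g (x, t) = u1 x t ^ m - u2 x t ^ m +
    ε * (exp (α * β * t) * exp (-α * ‖x‖ ^ 2) - κ₀) := rfl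
  have htI : t ∈ Ioo 0 T1 := ⟨hta.trans_le ht.1, ht.2.trans_lt htT⟩
  have b1 := hcM1 x hxρ hxR t (Ioo_subset_Icc_self htI)
  have b2 := hcM2 x hxρ hxR t (Ioo_subset_Icc_self htI)
  have hle := hweak x hxρ hxR t ht
  have hFle : u1 x t ^ m ≤ u2 x t ^ m := rpow_le_rpow (hc.le.trans b1.1) hle hm0.le
  set P := exp (α * β * t) * exp (-α * ‖x‖ ^ 2) with hP
  have hP0 : 0 < P := by positivity
  have hφpos : κ₀ < P := by
    by_contra! h
    nlinarith
  have hta' : ta < t := by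
    refine lt_of_le_of_ne ht.1 fun h => ?_
    have := hφa x hxρ hxR
    rw [h, ← hP] at this
    linarith
  have hxR' : ‖x‖ < R0 := by
    refine lt_of_le_of_ne hxR fun h => ?_
    have := hφR x h t ht
    linarith
  have hxρ' : ρ < ‖x‖ := by
    refine lt_of_le_of_ne hxρ fun h => ?_
    have := hφρ x h.symm t ht
    linarith
  have hxU : R1 < ‖x‖ := hρ.trans_le hxρ
  set a1 := lap n (fun y => u1 y t ^ m) x with ha1
  set a2 := lap n (fun y => u2 y t ^ m) x with ha2
  have hder : HasDerivAt (fun s => g (x, s)) (m * u1 x t ^ (m - 1) * a1 -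
      m * u2 x t ^ (m - 1) * a2 + ε * (α * β * P)) t := by
    have e1 := (((((hasDerivAt_id t).const_mul (α * β)).exp).mul_const
      (exp (-α * ‖x‖ ^ 2))).sub_const κ₀).const_mul ε
    have e2 := ((h1.hasDerivAt_rpow hxU htI).fun_sub (h2.hasDerivAt_rpow hxU htI)).fun_add e1
    refine HasDerivAt.congr_deriv (f := fun s => g (x, s)) e2 ?_
    simp only [id, hP, ha1, ha2]
    ring
  have htime := nonneg_of_hasDerivAt_of_left_max hta' hder fun s hs =>
    hmax x hxρ hxR s ⟨hs.1.le, hs.2.le.trans ht.2⟩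
  have hspace : a1 ≤ a2 + -(ε * (2 * α ^ 2 * ρ ^ 2 * P)) := by
    refine lap_le_of_secondDiff_le (isOpen_exterior n R1)
      (h1.contDiffOn_rpow (Ioo_subset_Ioc_self htI))
      (h2.contDiffOn_rpow (Ioo_subset_Ioc_self htI)) hxU ?_
    have hloc : ∀ᶠ y in 𝓝 x,
        (u1 y t ^ m + (ε * exp (α * β * t)) * exp (-α * ‖y‖ ^ 2)) - u2 y t ^ m ≤
        (u1 x t ^ m + (ε * exp (α * β * t)) * exp (-α * ‖x‖ ^ 2)) - u2 x t ^ m := by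
      filter_upwards [(isOpen_exterior n ρ).mem_nhds hxρ',
        (isOpen_lt continuous_norm continuous_const).mem_nhds hxR'] with y hy hy'
      have := hmax y (le_of_lt hy) (le_of_lt hy') t ht
      simp only [g] at this
      linarith
    have hsmall : ∀ᶠ h in 𝓝[>] (0 : ℝ), α * h ^ 2 < 1 / 4 := by
      have : Tendsto (fun h : ℝ => α * h ^ 2) (𝓝[>] 0) (𝓝 (α * 0 ^ 2)) :=
        (Continuous.tendsto (by fun_prop) 0).mono_left nhdsWithin_le_nhds
      exact this.eventually_lt_const (by norm_num)
    filter_upwards [secondDiff_le_of_isLocalMax hloc, hsmall] with h hh hh2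
    rw [secondDiff_add, secondDiff_const_mul (ε * exp (α * β * t))] at hh
    have hgs := le_secondDiff_gaussian (α := α) (h := h) x
    have hxx : ρ ^ 2 ≤ ‖x‖ ^ 2 := by gcongr
    have e0 : 2 * α ^ 2 * ρ ^ 2 ≤ 4 * α ^ 2 * ‖x‖ ^ 2 - 2 * n * α - 4 * α ^ 3 * h ^ 2 * ‖x‖ ^ 2 := by
      have i1 : 2 * n * α ≤ α * ρ ^ 2 * α := by gcongr
      have i2 : α ^ 2 * ρ ^ 2 ≤ α ^ 2 * ‖x‖ ^ 2 := by gcongr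
      have i3 : α ^ 2 * ‖x‖ ^ 2 * (α * h ^ 2) ≤ α ^ 2 * ‖x‖ ^ 2 * (1 / 4) := by gcongr
      linarith
    have e1 := mul_le_mul_of_nonneg_left e0 (exp_pos (-α * ‖x‖ ^ 2)).le
    have e2 := mul_le_mul_of_nonneg_right e1 (sq_nonneg h)
    have e3 := mul_le_mul_of_nonneg_left (e2.trans hgs) (mul_pos hε (exp_pos (α * β * t))).le
    have e4 : ε * (2 * α ^ 2 * ρ ^ 2 * P) * h ^ 2 = ε * exp (α * β * t) *
      (exp (-α * ‖x‖ ^ 2) * (2 * α ^ 2 * ρ ^ 2) * h ^ 2) := by rw [hP]; ring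
    linarith
  have hM := (hc.trans_le b1.1).trans_le b1.2
  have hk2 : m * M ^ (m - 1) ≤ m * u2 x t ^ (m - 1) :=
    mul_le_mul_of_nonneg_left (rpow_le_rpow_of_nonpos (hc.trans_le b2.1) b2.2 (by linarith)) hm0.le
  have hκ : 0 < m * M ^ (m - 1) := by positivity
  have hk12 : m * u2 x t ^ (m - 1) ≤ m * u1 x t ^ (m - 1) :=
    mul_le_mul_of_nonneg_left (rpow_le_rpow_of_nonpos (hc.trans_le b1.1) hle (by linarith)) hm0.le
  have hkd := rpow_sub_one_sub_le hm0 hm1 hc b1.1 hle b2.2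
  set k1 := m * u1 x t ^ (m - 1)
  set k2 := m * u2 x t ^ (m - 1)
  have hFφ : u2 x t ^ m - u1 x t ^ m ≤ ε * P := by
    have : 0 ≤ ε * κ₀ := by positivity
    linarith
  have hL : 0 ≤ M / c ^ 2 := by positivity
  have f1 : (k1 - k2) * a1 ≤ (k1 - k2) * C :=
    mul_le_mul_of_nonneg_left (hAB x hxρ hxR t ⟨ht.1, htI.2⟩) (sub_nonneg.2 hk12)
  have f2 : (k1 - k2) * C ≤ M / c ^ 2 * (ε * P) * C :=
    mul_le_mul_of_nonneg_right (hkd.trans (mul_le_mul_of_nonneg_left hFφ hL)) hC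
  have f3 : k2 * (a1 + ε * (2 * α ^ 2 * ρ ^ 2 * P)) ≤ k2 * a2 :=
    mul_le_mul_of_nonneg_left (by linarith) (hκ.le.trans hk2)
  have f4 : m * M ^ (m - 1) * (ε * (2 * α ^ 2 * ρ ^ 2 * P)) ≤ k2 * (ε * (2 * α ^ 2 * ρ ^ 2 * P)) :=
    mul_le_mul_of_nonneg_right hk2 (by positivity)
  have f5 := mul_lt_mul_of_pos_left hα (mul_pos hε hP0)
  linarith

end IsExteriorSolution

namespace IsExteriorSolution

variable {n : ℕ} {m R1 T1 : ℝ} {u1 u2 : EuclideanSpace ℝ (Fin n) → ℝ → ℝ}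

theorem lt_of_le (h1 : IsExteriorSolution n m R1 T1 u1) (h2 : IsExteriorSolution n m R1 T1 u2)
    (hm0 : 0 < m) (hm1 : m < 1) (hR1 : 0 < R1)
    (hbdry : ∀ x : EuclideanSpace ℝ (Fin n), ‖x‖ = R1 → ∀ t ∈ Ioc 0 T1, u1 x t < u2 x t)
    (hweak : ∀ x : EuclideanSpace ℝ (Fin n), R1 < ‖x‖ → ∀ t ∈ Ioo 0 T1, u1 x t ≤ u2 x t)
    {x₀ : EuclideanSpace ℝ (Fin n)} (hx₀ : R1 < ‖x₀‖) {t₁ : ℝ} (ht₁ : t₁ ∈ Ioc 0 T1) :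
    u1 x₀ t₁ < u2 x₀ t₁ := by
  obtain ⟨ht₁0, ht₁T⟩ := ht₁
  obtain ⟨ρ, hρ, hρx, hlayer⟩ := exists_layer h1 h2 hbdry (half_pos ht₁0) hx₀
  have hρ0 : 0 < ρ := hR1.trans hρ
  set R0 := ‖x₀‖ + 1 with hR0
  have hK := isCompact_shell n ρ R0
  have hKR : {x : EuclideanSpace ℝ (Fin n) | ρ ≤ ‖x‖ ∧ ‖x‖ ≤ R0} ⊆ {x | R1 < ‖x‖} :=
    fun x hx => hρ.trans_le hx.1
  have hKR' : {x : EuclideanSpace ℝ (Fin n) | ρ ≤ ‖x‖ ∧ ‖x‖ ≤ R0} ⊆ {x | R1 ≤ ‖x‖} :=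
    fun x hx => hρ.le.trans hx.1
  obtain ⟨c1, M1, hc1, hM1, hcM1⟩ := h1.exists_bounds hK hKR'
  obtain ⟨c2, M2, hc2, hM2, hcM2⟩ := h2.exists_bounds hK hKR'
  obtain ⟨C, hC, hAB⟩ := h1.exists_lap_le hm0 hm1 hK hKR (half_pos ht₁0)
  obtain ⟨c, hcdef⟩ : ∃ c, c = min c1 c2 := ⟨_, rfl⟩
  obtain ⟨M, hMdef⟩ : ∃ M, M = max M1 M2 := ⟨_, rfl⟩
  have hc : 0 < c := by rw [hcdef]; exact lt_min hc1 hc2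
  have hM : 0 < M := by rw [hMdef]; exact lt_max_of_lt_left hM1
  set β := (R0 ^ 2 - ρ ^ 2) / (t₁ - t₁ / 2) with hβ
  have hβ0 : 0 < β := by
    have : ρ ^ 2 < R0 ^ 2 := by
      apply pow_lt_pow_left₀ _ hρ0.le two_ne_zero
      linarith
    exact div_pos (by linarith) (by linarith)
  have hβmul : β * (t₁ - t₁ / 2) = R0 ^ 2 - ρ ^ 2 := div_mul_cancel₀ _ (by linarith)
  set κ := m * M ^ (m - 1) with hκ
  have hκ0 : 0 < κ := by positivity
  obtain ⟨α, hα1, hα2, hα3⟩ : ∃ α : ℝ, 1 ≤ α ∧ 2 * n ≤ α * ρ ^ 2 ∧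
      β + M / c ^ 2 * C + 1 ≤ 2 * κ * ρ ^ 2 * α := by
    refine ⟨max 1 (max (2 * n / ρ ^ 2) ((β + M / c ^ 2 * C + 1) / (2 * κ * ρ ^ 2))),
      le_max_left _ _, ?_, ?_⟩
    · rw [← div_le_iff₀ (by positivity)]
      exact (le_max_left _ _).trans (le_max_right _ _)
    · rw [← div_le_iff₀' (by positivity)]
      exact (le_max_right _ _).trans (le_max_right _ _)
  have hα0 : 0 < α := one_pos.trans_le hα1
  have hα : α * β + M / c ^ 2 * C < 2 * κ * ρ ^ 2 * α ^ 2 := by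
    have i1 : 0 ≤ M / c ^ 2 * C := by positivity
    have i2 := mul_le_mul_of_nonneg_left hα3 hα0.le
    have i3 := mul_le_mul_of_nonneg_right hα1 i1
    linarith
  set κ₀ := exp (-α * (R0 ^ 2 - β * t₁)) with hκ₀
  have hφ : ∀ (x : EuclideanSpace ℝ (Fin n)) (t : ℝ), R0 ^ 2 - β * t₁ ≤ ‖x‖ ^ 2 - β * t →
      exp (α * β * t) * exp (-α * ‖x‖ ^ 2) ≤ κ₀ := by
    intro x t h
    rw [← exp_add, hκ₀, exp_le_exp]
    have := mul_le_mul_of_nonneg_left h hα0.le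
    linarith
  obtain ⟨δ, hδ, hδle⟩ : ∃ δ, 0 < δ ∧ ∀ x : EuclideanSpace ℝ (Fin n), ‖x‖ = ρ →
      ∀ t ∈ Icc (t₁ / 2) t₁, δ ≤ u2 x t ^ m - u1 x t ^ m := by
    have hS : IsCompact (Metric.sphere (0 : EuclideanSpace ℝ (Fin n)) ρ ×ˢ Icc (t₁ / 2) t₁) :=
      (isCompact_sphere _ _).prod isCompact_Icc
    have hsub : Metric.sphere (0 : EuclideanSpace ℝ (Fin n)) ρ ×ˢ Icc (t₁ / 2) t₁ ⊆
        {x : EuclideanSpace ℝ (Fin n) | R1 ≤ ‖x‖} ×ˢ Icc 0 T1 := fun p hp => by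
      have : ‖p.1‖ = ρ := by simpa using hp.1
      exact ⟨show R1 ≤ ‖p.1‖ by linarith, by linarith [hp.2.1], by linarith [hp.2.2]⟩
    rcases (Metric.sphere (0 : EuclideanSpace ℝ (Fin n)) ρ ×ˢ
      Icc (t₁ / 2) t₁).eq_empty_or_nonempty with he | hne
    · refine ⟨1, one_pos, fun x hx t ht => ?_⟩
      have : (x, t) ∈ Metric.sphere (0 : EuclideanSpace ℝ (Fin n)) ρ ×ˢ Icc (t₁ / 2) t₁ :=
        ⟨by simpa using hx, ht⟩
      simp [he] at this
    · obtain ⟨p, hp, hpmin⟩ := hS.exists_isMinOn hne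
        ((h2.continuousOn_rpow.mono hsub).sub (h1.continuousOn_rpow.mono hsub))
      have hp1 : ‖p.1‖ = ρ := by simpa using hp.1
      refine ⟨u2 p.1 p.2 ^ m - u1 p.1 p.2 ^ m, sub_pos.2 ?_, fun x hx t ht =>
        hpmin (a := (x, t)) ⟨by simpa using hx, ht⟩⟩
      exact rpow_lt_rpow (h1.pos _ (hsub hp).1 _ (hsub hp).2).le
        (hlayer p.1 (hsub hp).1 hp1.le p.2 ⟨hp.2.1, hp.2.2.trans ht₁T⟩) hm0
  set ε := δ / exp (α * β * t₁) with hεdef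
  have hε : 0 < ε := by positivity
  have hmain : ∀ t ∈ Ico (t₁ / 2) t₁, ε * (exp (α * β * t) * exp (-α * ‖x₀‖ ^ 2) - κ₀) ≤
      u2 x₀ t ^ m - u1 x₀ t ^ m := by
    intro t ht
    refine gaussian_barrier_le (R0 := R0) (ta := t₁ / 2) (t' := t) (C := C) (c := c) (M := M)
      h1 h2 hm0 hm1 hρ0 hρ (half_pos ht₁0) (ht.2.trans_le ht₁T) hc hC hε (exp_pos _).le hα0
      (fun x hx hx' s hs => ?_) (fun x hx hx' s hs => ?_) (fun x hx hx' s hs => hAB x ⟨hx, hx'⟩ s hs)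
      (fun x hx _ s hs => hweak x (hρ.trans_le hx) s
        ⟨by linarith [hs.1], by linarith [hs.2, ht.2]⟩)
      (fun x hx _ => hφ _ _ ?_) (fun x hx s hs => hφ _ _ ?_) (fun x hx s hs => ?_) hα2 hα
      x₀ hρx.le (by linarith) t ⟨ht.1, le_rfl⟩
    · have := hcM1 x ⟨hx, hx'⟩ s hs
      rw [hcdef, hMdef]
      exact ⟨(min_le_left _ _).trans this.1, this.2.trans (le_max_left _ _)⟩
    · have := hcM2 x ⟨hx, hx'⟩ s hs
      rw [hcdef, hMdef]
      exact ⟨(min_le_right _ _).trans this.1, this.2.trans (le_max_right _ _)⟩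
    · have : ρ ^ 2 ≤ ‖x‖ ^ 2 := by gcongr
      linarith
    · rw [hx]
      have : β * s ≤ β * t₁ := by
        gcongr
        linarith [hs.2, ht.2]
      linarith
    · refine le_trans ?_ (hδle x hx s ⟨hs.1, by linarith [hs.2, ht.2]⟩)
      rw [hεdef, div_mul_eq_mul_div, div_le_iff₀ (exp_pos _)]
      refine mul_le_mul_of_nonneg_left ?_ hδ.le
      have e1 : exp (α * β * s) ≤ exp (α * β * t₁) := by
        gcongr
        linarith [hs.2, ht.2]
      have e2 : exp (-α * ‖x‖ ^ 2) ≤ 1 := exp_le_one_iff.2 (by nlinarith [sq_nonneg ‖x‖])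
      have e3 := mul_le_mul e1 e2 (exp_pos _).le (exp_pos _).le
      have e4 : 0 < κ₀ := exp_pos _
      linarith
  have hIcc : t₁ ∈ Icc 0 T1 := ⟨ht₁0.le, ht₁T⟩
  have hsubI : Ico (t₁ / 2) t₁ ⊆ Icc 0 T1 := fun s hs => ⟨by linarith [hs.1], by linarith [hs.2]⟩
  have hc1 : ContinuousWithinAt (fun t => u1 x₀ t ^ m) (Ico (t₁ / 2) t₁) t₁ :=
    (((h1.continuousOn_time hx₀.le) t₁ hIcc).mono hsubI).rpow_const
      (Or.inl (h1.pos x₀ hx₀.le t₁ hIcc).ne')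
  have hc2 : ContinuousWithinAt (fun t => u2 x₀ t ^ m) (Ico (t₁ / 2) t₁) t₁ :=
    (((h2.continuousOn_time hx₀.le) t₁ hIcc).mono hsubI).rpow_const
      (Or.inl (h2.pos x₀ hx₀.le t₁ hIcc).ne')
  have hc3 : ContinuousWithinAt (fun t => ε * (exp (α * β * t) * exp (-α * ‖x₀‖ ^ 2) - κ₀))
      (Ico (t₁ / 2) t₁) t₁ := Continuous.continuousWithinAt (by fun_prop)
  have := right_nhdsWithin_Ico_neBot (half_lt_self ht₁0)
  have hlim := le_of_tendsto_of_tendsto hc3 (hc2.sub hc1)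
    (by filter_upwards [self_mem_nhdsWithin] with t ht using hmain t ht)
  have hpos : 0 < ε * (exp (α * β * t₁) * exp (-α * ‖x₀‖ ^ 2) - κ₀) := by
    refine mul_pos hε (sub_pos.2 ?_)
    rw [hκ₀, ← exp_add, exp_lt_exp]
    have : ‖x₀‖ ^ 2 < R0 ^ 2 := pow_lt_pow_left₀ (by linarith) (norm_nonneg _) two_ne_zero
    have := mul_lt_mul_of_pos_left this hα0
    linarith
  refine lt_of_not_ge fun h => ?_
  have := rpow_le_rpow (h2.pos x₀ hx₀.le t₁ hIcc).le h hm0.le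
  simp only [Pi.sub_apply] at hlim
  linarith

end IsExteriorSolution

/-- The right derivative of the positive part of a function with value `a` and derivative `b`. -/
noncomputable def posPartDeriv (a b : ℝ) : ℝ :=
  if 0 < a then b else if a = 0 then max b 0 else 0

theorem posPartDeriv_of_pos {a b : ℝ} (h : 0 < a) : posPartDeriv a b = b := if_pos h

theorem posPartDeriv_zero (b : ℝ) : posPartDeriv 0 b = max b 0 := by simp [posPartDeriv]

theorem posPartDeriv_of_neg {a b : ℝ} (h : a < 0) : posPartDeriv a b = 0 := by
  simp [posPartDeriv, h.not_gt, h.ne]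

theorem abs_posPartDeriv_le (a b : ℝ) : |posPartDeriv a b| ≤ |b| := by
  rcases lt_trichotomy a 0 with h | rfl | h
  · simp [posPartDeriv_of_neg h]
  · rw [posPartDeriv_zero]
    rcases le_total b 0 with hb | hb
    · simp [max_eq_right hb]
    · simp [max_eq_left hb]
  · rw [posPartDeriv_of_pos h]

theorem posPartDeriv_mul_right (a b : ℝ) {c : ℝ} (hc : 0 ≤ c) :
    posPartDeriv a (b * c) = posPartDeriv a b * c := by
  rcases lt_trichotomy a 0 with h | rfl | h
  · simp [posPartDeriv_of_neg h]
  · rw [posPartDeriv_zero, posPartDeriv_zero, max_mul_of_nonneg _ _ hc, zero_mul]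
  · rw [posPartDeriv_of_pos h, posPartDeriv_of_pos h]

theorem continuous_posPartDeriv (a : ℝ) : Continuous (posPartDeriv a) := by
  rcases lt_trichotomy a 0 with h | rfl | h
  · exact continuous_const.congr fun b => (posPartDeriv_of_neg h).symm
  · exact (continuous_id.max continuous_const).congr fun b => (posPartDeriv_zero b).symm
  · exact continuous_id.congr fun b => (posPartDeriv_of_pos h).symm

theorem measurable_posPartDeriv {α : Type*} [MeasurableSpace α] {f g : α → ℝ} (hf : Measurable f)
    (hg : Measurable g) : Measurable fun x => posPartDeriv (f x) (g x) :=
  Measurable.ite (measurableSet_lt measurable_const hf) hg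
    (Measurable.ite (hf (measurableSet_singleton 0)) (hg.max measurable_const) measurable_const)

theorem hasDerivWithinAt_posPart {f : ℝ → ℝ} {f' t : ℝ} (hf : HasDerivAt f f' t) :
    HasDerivWithinAt (fun s => max (f s) 0) (posPartDeriv (f t) f') (Ioi t) t := by
  rcases lt_trichotomy (f t) 0 with h | h | h
  · rw [posPartDeriv_of_neg h]
    refine ((hasDerivAt_const t (0 : ℝ)).congr_of_eventuallyEq ?_).hasDerivWithinAt
    filter_upwards [hf.continuousAt.eventually_lt_const h] with s hs using max_eq_right hs.le
  · rw [h, posPartDeriv_zero, hasDerivWithinAt_iff_tendsto_slope' self_notMem_Ioi]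
    have h1 := (hasDerivWithinAt_iff_tendsto_slope' self_notMem_Ioi).1
      (hf.hasDerivWithinAt (s := Ioi t))
    refine (h1.max (tendsto_const_nhds (x := (0 : ℝ)))).congr' ?_
    filter_upwards [self_mem_nhdsWithin] with s hs
    have hs' : 0 < s - t := sub_pos.2 hs
    simp only [slope_def_field, h, max_self, sub_zero]
    rw [← max_div_div_right hs'.le, zero_div]
  · rw [posPartDeriv_of_pos h]
    refine (hf.congr_of_eventuallyEq ?_).hasDerivWithinAt
    filter_upwards [hf.continuousAt.eventually_const_lt h] with s hs using max_eq_left hs.le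

theorem posPartDeriv_secondDiff_le {n : ℕ} (w : EuclideanSpace ℝ (Fin n) → ℝ) (h : ℝ)
    (x : EuclideanSpace ℝ (Fin n)) :
    posPartDeriv (w x) (secondDiff w h x) ≤ secondDiff (fun y => max (w y) 0) h x := by
  have key : w x ≤ 0 → 0 ≤ secondDiff (fun y => max (w y) 0) h x := fun hx => by
    refine Finset.sum_nonneg fun i _ => ?_
    dsimp only
    rw [max_eq_right hx, mul_zero, sub_zero]
    positivity
  have key2 : 0 ≤ w x → secondDiff w h x ≤ secondDiff (fun y => max (w y) 0) h x := fun hx => by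
    refine Finset.sum_le_sum fun i _ => ?_
    dsimp only
    rw [max_eq_left hx]
    gcongr <;> exact le_max_left _ _
  rcases lt_trichotomy (w x) 0 with hx | hx | hx
  · rw [posPartDeriv_of_neg hx]
    exact key hx.le
  · rw [hx, posPartDeriv_zero]
    exact max_le (key2 hx.ge) (key hx.le)
  · rw [posPartDeriv_of_pos hx]
    exact key2 hx.le

theorem integral_mul_secondDiff_comm {n : ℕ} {f g : EuclideanSpace ℝ (Fin n) → ℝ}
    (hf : Continuous f) (hg : Continuous g) (hfc : HasCompactSupport f) (h : ℝ) :
    ∫ x, f x * secondDiff g h x = ∫ x, secondDiff f h x * g x := by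
  have hint : ∀ v w : EuclideanSpace ℝ (Fin n), Integrable fun x => f (x + v) * g (x + w) :=
    fun v w => Continuous.integrable_of_hasCompactSupport (by fun_prop)
      ((hfc.comp_homeomorph (Homeomorph.addRight v)).mul_right)
  have hint1 : ∀ w : EuclideanSpace ℝ (Fin n), Integrable fun x => f x * g (x + w) :=
    fun w => by simpa using hint 0 w
  have hint2 : ∀ w : EuclideanSpace ℝ (Fin n), Integrable fun x => f (x + w) * g x :=
    fun w => by simpa using hint w 0
  have hint0 : Integrable fun x => f x * g x := by simpa using hint 0 0
  have hshift : ∀ v : EuclideanSpace ℝ (Fin n),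
      ∫ x, f x * g (x + v) = ∫ x, f (x + -v) * g x := fun v => by
    rw [← integral_add_right_eq_self (fun x => f (x + -v) * g x) v]
    simp
  have e1 : ∫ x, f x * secondDiff g h x = ∑ i : Fin n,
      ((∫ x, f x * g (x + h • EuclideanSpace.single i (1 : ℝ))) +
      (∫ x, f x * g (x + -(h • EuclideanSpace.single i (1 : ℝ)))) - 2 * ∫ x, f x * g x) := by
    simp only [secondDiff, Finset.mul_sum]
    rw [integral_finsetSum]
    · refine Finset.sum_congr rfl fun i _ => ?_
      have hadd : Integrable fun x => f x * g (x + h • EuclideanSpace.single i (1 : ℝ)) +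
          f x * g (x + -(h • EuclideanSpace.single i (1 : ℝ))) :=
        (hint1 _).add (hint1 _)
      rw [← integral_add (hint1 _) (hint1 _), ← integral_const_mul,
        ← integral_sub hadd (hint0.const_mul 2)]
      refine integral_congr_ae (Eventually.of_forall fun x => ?_)
      simp only [sub_eq_add_neg]
      ring
    · intro i _
      refine (((hint1 (h • EuclideanSpace.single i (1 : ℝ))).add
        (hint1 (-(h • EuclideanSpace.single i (1 : ℝ))))).sub (hint0.const_mul 2)).congr
        (Eventually.of_forall fun x => ?_)
      simp only [Pi.add_apply, Pi.sub_apply, sub_eq_add_neg]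
      ring
  have e2 : ∫ x, secondDiff f h x * g x = ∑ i : Fin n,
      ((∫ x, f (x + h • EuclideanSpace.single i (1 : ℝ)) * g x) +
      (∫ x, f (x + -(h • EuclideanSpace.single i (1 : ℝ))) * g x) - 2 * ∫ x, f x * g x) := by
    simp only [secondDiff, Finset.sum_mul]
    rw [integral_finsetSum]
    · refine Finset.sum_congr rfl fun i _ => ?_
      have hadd : Integrable fun x => f (x + h • EuclideanSpace.single i (1 : ℝ)) * g x +
          f (x + -(h • EuclideanSpace.single i (1 : ℝ))) * g x :=
        (hint2 _).add (hint2 _)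
      rw [← integral_add (hint2 _) (hint2 _), ← integral_const_mul,
        ← integral_sub hadd (hint0.const_mul 2)]
      refine integral_congr_ae (Eventually.of_forall fun x => ?_)
      simp only [sub_eq_add_neg]
      ring
    · intro i _
      refine (((hint2 (h • EuclideanSpace.single i (1 : ℝ))).add
        (hint2 (-(h • EuclideanSpace.single i (1 : ℝ))))).sub (hint0.const_mul 2)).congr
        (Eventually.of_forall fun x => ?_)
      simp only [Pi.add_apply, Pi.sub_apply, sub_eq_add_neg]
      ring
  rw [e1, e2]
  refine Finset.sum_congr rfl fun i _ => ?_
  rw [hshift, hshift, neg_neg]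
  ring

theorem Continuous.secondDiff {n : ℕ} {f : EuclideanSpace ℝ (Fin n) → ℝ} (hf : Continuous f)
    (h : ℝ) : Continuous (secondDiff f h) := by
  unfold _root_.secondDiff
  fun_prop

theorem Measurable.secondDiff {n : ℕ} {f : EuclideanSpace ℝ (Fin n) → ℝ} (hf : Measurable f)
    (h : ℝ) : Measurable (secondDiff f h) := by
  unfold _root_.secondDiff
  fun_prop

theorem secondDiff_eq_zero {n : ℕ} {f : EuclideanSpace ℝ (Fin n) → ℝ} {c h : ℝ}
    {x : EuclideanSpace ℝ (Fin n)} (hf : ∀ y, ‖y - x‖ ≤ |h| → f y = c) : secondDiff f h x = 0 := by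
  refine Finset.sum_eq_zero fun i _ => ?_
  rw [hf _ (by simp [norm_smul_single]), hf (x - _) (by simp [norm_smul_single]), hf x (by simp)]
  ring

/-- Kato's inequality, tested against a compactly supported cutoff. -/
theorem integral_mul_posPartDeriv_lap_le {n : ℕ} {w η : EuclideanSpace ℝ (Fin n) → ℝ} {a ρ k : ℝ}
    (hw : Measurable w) (hwC : ContDiffOn ℝ 2 w {x | a < ‖x‖}) (hρ : a < ρ)
    (hwρ : ∀ x, ‖x‖ ≤ ρ → w x ≤ 0) (hη : Continuous η) (hηc : HasCompactSupport η)
    (hη0 : ∀ x, 0 ≤ η x) (hηs : tsupport η ⊆ {x | a < ‖x‖})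
    {S : Set (EuclideanSpace ℝ (Fin n))} (hS : IsCompact S)
    (hηS : ∀ᶠ h in 𝓝[>] (0 : ℝ), ∀ x, ρ < ‖x‖ →
      secondDiff η h x ≤ S.indicator (fun _ => k) x * h ^ 2) :
    ∫ x, η x * posPartDeriv (w x) (lap n w x) ≤ k * ∫ x in S, max (w x) 0 := by
  have hU := isOpen_exterior n a
  have hW : Continuous fun x => max (w x) 0 := by
    rw [continuous_iff_continuousAt]
    intro x
    rcases lt_or_ge a ‖x‖ with hx | hx
    · exact (hwC.continuousOn.continuousAt (hU.mem_nhds hx)).max continuousAt_const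
    · refine continuousAt_const.congr (f := fun _ => (0 : ℝ)) ?_
      filter_upwards [(isOpen_lt continuous_norm continuous_const).mem_nhds
        (show ‖x‖ < ρ by linarith)] with y hy
      exact (max_eq_right (hwρ y (le_of_lt hy))).symm
  obtain ⟨C, h₀, hC, hh₀, hbound⟩ := exists_abs_secondDiff_le hU hwC hηc hηs
  obtain ⟨N, hN⟩ := hη.bounded_above_of_compact_support hηc
  have hN0 : 0 ≤ N := (norm_nonneg _).trans (hN 0)
  have hsmall : ∀ᶠ h in 𝓝[>] (0 : ℝ), h ∈ Ioc 0 h₀ := Ioc_mem_nhdsGT hh₀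
  have hbd : ∀ h ∈ Ioc 0 h₀, ∀ x, ‖η x * posPartDeriv (w x) (secondDiff w h x / h ^ 2)‖ ≤
      (tsupport η).indicator (fun _ => N * C) x := by
    intro h hh x
    by_cases hx : x ∈ tsupport η
    · rw [indicator_of_mem hx, norm_mul]
      refine mul_le_mul (hN x) ((abs_posPartDeriv_le _ _).trans ?_) (norm_nonneg _) hN0
      have := pow_pos hh.1 2
      rw [abs_div, abs_of_pos this, div_le_iff₀ this]
      exact hbound x hx h hh.1 hh.2
    · rw [image_eq_zero_of_notMem_tsupport hx, zero_mul, norm_zero]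
      exact indicator_nonneg (fun _ _ => by positivity) x
  have hbi : Integrable ((tsupport η).indicator fun _ => N * C) :=
    (integrable_indicator_iff (isClosed_tsupport η).measurableSet).2
      (integrableOn_const hηc.measure_lt_top.ne)
  have hmeas : ∀ h, AEStronglyMeasurable
      (fun x => η x * posPartDeriv (w x) (secondDiff w h x / h ^ 2)) volume := fun h =>
    (hη.measurable.mul (measurable_posPartDeriv hw ((hw.secondDiff h).div_const _))).aestronglyMeasurable
  have hlim : Tendsto (fun h => ∫ x, η x * posPartDeriv (w x) (secondDiff w h x / h ^ 2))
      (𝓝[>] 0) (𝓝 (∫ x, η x * posPartDeriv (w x) (lap n w x))) := by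
    refine tendsto_integral_filter_of_dominated_convergence _
      (Eventually.of_forall hmeas) ?_ hbi (Eventually.of_forall fun x => ?_)
    · filter_upwards [hsmall] with h hh using Eventually.of_forall (hbd h hh)
    · by_cases hx : x ∈ tsupport η
      · exact (((continuous_posPartDeriv (w x)).tendsto _).comp
          (tendsto_secondDiff hU hwC (hηs hx))).const_mul _
      · simp [image_eq_zero_of_notMem_tsupport hx]
  refine le_of_tendsto hlim ?_
  filter_upwards [hsmall, hηS] with h hh hhS
  have hh2 : 0 < h ^ 2 := pow_pos hh.1 2
  have hsd : Integrable fun x => η x * secondDiff (fun y => max (w y) 0) h x :=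
    (hη.mul (hW.secondDiff h)).integrable_of_hasCompactSupport hηc.mul_right
  have hsdη : HasCompactSupport (secondDiff η h) := by
    have hc : ∀ v : EuclideanSpace ℝ (Fin n), HasCompactSupport fun x => η (x + v) := fun v =>
      hηc.comp_homeomorph (Homeomorph.addRight v)
    obtain ⟨r, hr⟩ := hηc.isBounded.subset_closedBall 0
    refine HasCompactSupport.intro (isCompact_closedBall (0 : EuclideanSpace ℝ (Fin n)) (r + |h|))
      fun x hx => secondDiff_eq_zero (c := 0) fun y hy => image_eq_zero_of_notMem_tsupport fun hy' => ?_
    have h1 : ‖y‖ ≤ r := by simpa using hr hy'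
    refine hx (mem_closedBall_zero_iff.2 ?_)
    have := norm_sub_norm_le x y
    rw [norm_sub_rev] at this
    linarith
  calc ∫ x, η x * posPartDeriv (w x) (secondDiff w h x / h ^ 2)
      ≤ ∫ x, η x * secondDiff (fun y => max (w y) 0) h x / h ^ 2 := by
        refine integral_mono (hbi.mono' (hmeas h) (Eventually.of_forall (hbd h hh)))
          (hsd.div_const _) fun x => ?_
        dsimp only
        rw [div_eq_mul_inv, posPartDeriv_mul_right _ _ (by positivity), mul_div_assoc,
          div_eq_mul_inv]
        exact mul_le_mul_of_nonneg_left (mul_le_mul_of_nonneg_right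
          (posPartDeriv_secondDiff_le w h x) (by positivity)) (hη0 x)
    _ = ∫ x, secondDiff η h x * max (w x) 0 / h ^ 2 := by
        rw [integral_div, integral_div, integral_mul_secondDiff_comm hη hW hηc]
    _ ≤ ∫ x, S.indicator (fun x => k * max (w x) 0) x := by
        refine integral_mono (((((hη.secondDiff h).mul hW).integrable_of_hasCompactSupport
          hsdη.mul_right)).div_const _) ?_ fun x => ?_
        · exact (integrable_indicator_iff hS.measurableSet).2
            (hW.continuousOn.const_smul k |>.integrableOn_compact hS)
        · dsimp only
          rcases le_or_gt ‖x‖ ρ with hx | hx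
          · by_cases hxS : x ∈ S <;> simp [hxS, max_eq_right (hwρ x hx)]
          · have h1 := mul_le_mul_of_nonneg_right (hhS x hx) (le_max_right (w x) 0)
            rw [div_le_iff₀ hh2]
            by_cases hxS : x ∈ S
            · rw [indicator_of_mem hxS] at h1 ⊢
              linarith
            · rw [indicator_of_notMem hxS] at h1 ⊢
              linarith
    _ = k * ∫ x in S, max (w x) 0 := by
        rw [integral_indicator hS.measurableSet, integral_const_mul]

theorem secondDiff_comp_smul {n : ℕ} (f : EuclideanSpace ℝ (Fin n) → ℝ) (c h : ℝ)
    (x : EuclideanSpace ℝ (Fin n)) :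
    secondDiff (fun y => f (c • y)) h x = secondDiff f (c * h) (c • x) := by
  simp only [secondDiff, smul_add, smul_sub, smul_smul]

/-- Annular cutoffs whose second differences away from the inner boundary are `O(h² / R²)`,
uniformly in the inner radii. -/
theorem exists_cutoff (n : ℕ) : ∃ C : ℝ, 0 ≤ C ∧ ∀ a b ρ R : ℝ, 0 < a → a < b → b < ρ → b < R →
    ∃ η : EuclideanSpace ℝ (Fin n) → ℝ, Continuous η ∧ HasCompactSupport η ∧ (∀ x, 0 ≤ η x) ∧
      (∀ x, η x ≤ 1) ∧ (∀ x, b ≤ ‖x‖ → ‖x‖ ≤ R → η x = 1) ∧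
      tsupport η ⊆ {x | a ≤ ‖x‖ ∧ ‖x‖ ≤ 2 * R} ∧
      ∀ᶠ h in 𝓝[>] (0 : ℝ), ∀ x, ρ < ‖x‖ → secondDiff η h x ≤
        {x : EuclideanSpace ℝ (Fin n) | R / 2 ≤ ‖x‖ ∧ ‖x‖ ≤ 3 * R}.indicator
          (fun _ => C / R ^ 2) x * h ^ 2 := by
  let χ : ContDiffBump (0 : EuclideanSpace ℝ (Fin n)) := ⟨1, 2, one_pos, one_lt_two⟩
  have hχ1 : ∀ x, ‖x‖ ≤ 1 → χ x = 1 := fun x hx =>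
    χ.one_of_mem_closedBall (mem_closedBall_zero_iff.2 hx)
  have hχ0 : ∀ x, 2 ≤ ‖x‖ → χ x = 0 := fun x hx =>
    χ.zero_of_le_dist (by rwa [dist_zero_right])
  obtain ⟨C, h₀, hC, hh₀, hbd⟩ := exists_abs_secondDiff_le isOpen_univ
    (χ.contDiff (n := 2)).contDiffOn (isCompact_closedBall 0 4) (subset_univ _)
  refine ⟨C, hC, fun a b ρ R ha hab hbρ hbR => ?_⟩
  have hR : 0 < R := by linarith
  let ξ : ContDiffBump (0 : EuclideanSpace ℝ (Fin n)) := ⟨a, b, ha, hab⟩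
  have hξ1 : ∀ x, ‖x‖ ≤ a → ξ x = 1 := fun x hx =>
    ξ.one_of_mem_closedBall (mem_closedBall_zero_iff.2 hx)
  have hξ0 : ∀ x, b ≤ ‖x‖ → ξ x = 0 := fun x hx =>
    ξ.zero_of_le_dist (by rwa [dist_zero_right])
  have hnorm : ∀ x : EuclideanSpace ℝ (Fin n), ‖R⁻¹ • x‖ = ‖x‖ / R := fun x => by
    rw [norm_smul, norm_inv, Real.norm_of_nonneg hR.le, inv_mul_eq_div]
  have hX1 : ∀ x, ‖x‖ ≤ R → χ (R⁻¹ • x) = 1 := fun x hx =>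
    hχ1 _ (by rw [hnorm]; exact (div_le_one hR).2 hx)
  have hX0 : ∀ x, 2 * R ≤ ‖x‖ → χ (R⁻¹ • x) = 0 := fun x hx =>
    hχ0 _ (by rw [hnorm]; exact (le_div_iff₀ hR).2 hx)
  set η : EuclideanSpace ℝ (Fin n) → ℝ := fun x => χ (R⁻¹ • x) - ξ x with hη
  have hts : tsupport η ⊆ {x | a ≤ ‖x‖ ∧ ‖x‖ ≤ 2 * R} := by
    refine closure_minimal (fun x hx => ?_) (isCompact_shell n a (2 * R)).isClosed
    by_contra hcon
    refine hx ?_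
    rw [mem_ofPred_eq, not_and_or, not_le, not_le] at hcon
    rcases hcon with hcon | hcon
    · simp [hη, hX1 x (by linarith), hξ1 x hcon.le]
    · simp [hη, hX0 x hcon.le, hξ0 x (by linarith)]
  refine ⟨η, ?_, (isCompact_shell n a (2 * R)).of_isClosed_subset (isClosed_tsupport η) hts,
    fun x => ?_, fun x => ?_, fun x hxb hxR => ?_, hts, ?_⟩
  · exact (χ.continuous.comp (continuous_const_smul R⁻¹)).sub ξ.continuous
  · rcases le_total ‖x‖ b with hx | hx
    · simp only [hη, hX1 x (by linarith)]
      linarith [ξ.le_one (x := x)]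
    · simp only [hη, hξ0 x hx]
      linarith [χ.nonneg (x := R⁻¹ • x)]
  · linarith [ξ.nonneg (x := x), χ.le_one (x := R⁻¹ • x)]
  · simp [hη, hX1 x hxR, hξ0 x hxb]
  · have hpos : 0 < min (ρ - b) (min (R / 2) (R * h₀)) :=
      lt_min (by linarith) (lt_min (by linarith) (by positivity))
    filter_upwards [Ioc_mem_nhdsGT hpos] with h hh x hx
    obtain ⟨hh0, hh1⟩ := hh
    rw [le_min_iff, le_min_iff] at hh1
    obtain ⟨hhρ, hhR, hhh⟩ := hh1
    have hnear : ∀ y : EuclideanSpace ℝ (Fin n), ‖y - x‖ ≤ |h| → |‖y‖ - ‖x‖| ≤ h := fun y hy =>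
      (abs_norm_sub_norm_le y x).trans (hy.trans_eq (abs_of_pos hh0))
    have hξz : secondDiff ξ h x = 0 := secondDiff_eq_zero (c := 0) fun y hy =>
      hξ0 y (by linarith [(abs_le.1 (hnear y hy)).1])
    rw [hη, secondDiff_sub, hξz, sub_zero]
    by_cases hxS : x ∈ {x : EuclideanSpace ℝ (Fin n) | R / 2 ≤ ‖x‖ ∧ ‖x‖ ≤ 3 * R}
    · rw [indicator_of_mem hxS, secondDiff_comp_smul]
      have h1 := hbd (R⁻¹ • x) (mem_closedBall_zero_iff.2 (by
        rw [hnorm, div_le_iff₀ hR]; linarith [hxS.2])) (R⁻¹ * h) (by positivity)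
        (by rw [inv_mul_le_iff₀ hR]; exact hhh)
      refine (le_abs_self _).trans (h1.trans_eq ?_)
      field_simp
    · rw [indicator_of_notMem hxS, zero_mul]
      rw [mem_ofPred_eq, not_and_or, not_le, not_le] at hxS
      rcases hxS with hxS | hxS
      · exact (secondDiff_eq_zero (c := 1) fun y hy =>
          hX1 y (by linarith [(abs_le.1 (hnear y hy)).2])).le
      · exact (secondDiff_eq_zero (c := 0) fun y hy =>
          hX0 y (by linarith [(abs_le.1 (hnear y hy)).1])).le

theorem lap_sub {n : ℕ} {f g : EuclideanSpace ℝ (Fin n) → ℝ} {U : Set (EuclideanSpace ℝ (Fin n))}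
    (hU : IsOpen U) (hf : ContDiffOn ℝ 2 f U) (hg : ContDiffOn ℝ 2 g U)
    {x : EuclideanSpace ℝ (Fin n)} (hx : x ∈ U) :
    lap n (fun y => f y - g y) x = lap n f x - lap n g x := by
  refine tendsto_nhds_unique (tendsto_secondDiff hU (hf.sub hg) hx)
    (((tendsto_secondDiff hU hf hx).sub (tendsto_secondDiff hU hg hx)).congr fun h => ?_)
  rw [← sub_div, ← secondDiff_sub]

theorem continuousOn_setIntegral_of_isCompact {n : ℕ} {K : Set (EuclideanSpace ℝ (Fin n))}
    (hK : IsCompact K) {G : EuclideanSpace ℝ (Fin n) → ℝ → ℝ} {a b : ℝ}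
    (hG : ContinuousOn (fun p : EuclideanSpace ℝ (Fin n) × ℝ => G p.1 p.2) (K ×ˢ Icc a b)) :
    ContinuousOn (fun s => ∫ x in K, G x s) (Icc a b) := by
  obtain ⟨N, hN⟩ := (hK.prod isCompact_Icc).exists_bound_of_continuousOn hG
  refine continuousOn_of_dominated (bound := fun _ => N) (fun s hs => ?_) (fun s hs => ?_)
    (integrableOn_const hK.measure_lt_top.ne) ?_
  · have : ContinuousOn (fun x => G x s) K :=
      hG.comp (f := fun x => (x, s)) (by fun_prop) fun x hx => ⟨hx, hs⟩
    exact this.aestronglyMeasurable hK.measurableSet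
  · exact (ae_restrict_mem hK.measurableSet).mono fun x hx => hN (x, s) ⟨hx, hs⟩
  · exact (ae_restrict_mem hK.measurableSet).mono fun x hx =>
      hG.comp (f := fun s => (x, s)) (by fun_prop) fun s hs => ⟨hx, hs⟩

theorem integrable_mul_of_continuousOn {n : ℕ} {K : Set (EuclideanSpace ℝ (Fin n))}
    (hK : IsCompact K) {η g : EuclideanSpace ℝ (Fin n) → ℝ} (hη : Continuous η)
    (hηK : ∀ x, x ∉ K → η x = 0) (hg : ContinuousOn g K) : Integrable fun x => η x * g x := by
  refine ((integrable_indicator_iff hK.measurableSet).2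
    ((hη.continuousOn.mul hg).integrableOn_compact hK)).congr (Eventually.of_forall fun x => ?_)
  by_cases hx : x ∈ K
  · simp [hx]
  · simp [hx, hηK x hx]

namespace IsExteriorSolution

variable {n : ℕ} {m R1 T1 : ℝ} {u1 u2 : EuclideanSpace ℝ (Fin n) → ℝ → ℝ}

theorem continuousOn_posPart_sub (h1 : IsExteriorSolution n m R1 T1 u1)
    (h2 : IsExteriorSolution n m R1 T1 u2) :
    ContinuousOn (fun p : EuclideanSpace ℝ (Fin n) × ℝ => max (u1 p.1 p.2 - u2 p.1 p.2) 0)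
      ({x : EuclideanSpace ℝ (Fin n) | R1 ≤ ‖x‖} ×ˢ Icc 0 T1) :=
  (h1.cont.sub h2.cont).sup continuousOn_const

theorem hasDerivWithinAt_integral_posPart_sub (h1 : IsExteriorSolution n m R1 T1 u1)
    (h2 : IsExteriorSolution n m R1 T1 u2) (hm0 : 0 < m) (hm1 : m < 1)
    {K : Set (EuclideanSpace ℝ (Fin n))} (hK : IsCompact K)
    (hKR : K ⊆ {x : EuclideanSpace ℝ (Fin n) | R1 < ‖x‖}) {η : EuclideanSpace ℝ (Fin n) → ℝ}
    (hη : Continuous η) (hηK : ∀ x, x ∉ K → η x = 0) (hη0 : ∀ x, 0 ≤ η x) (hη1 : ∀ x, η x ≤ 1)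
    {t : ℝ} (ht : t ∈ Ioo 0 T1) :
    HasDerivWithinAt (fun s => ∫ x, η x * max (u1 x s - u2 x s) 0)
      (∫ x, η x * posPartDeriv (u1 x t - u2 x t)
        (lap n (fun y => u1 y t ^ m) x - lap n (fun y => u2 y t ^ m) x)) (Ici t) t := by
  have htT : t < (t + T1) / 2 := by linarith [ht.2]
  have hTT : (t + T1) / 2 < T1 := by linarith [ht.2]
  obtain ⟨C1, hC1, hL1⟩ := h1.exists_forward_lipschitz hm0 hm1 hK hKR ht.1 hTT
  obtain ⟨C2, hC2, hL2⟩ := h2.exists_forward_lipschitz hm0 hm1 hK hKR ht.1 hTT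
  have hint : ∀ s ∈ Icc 0 T1, Integrable fun x => η x * max (u1 x s - u2 x s) 0 := fun s hs =>
    integrable_mul_of_continuousOn hK hη hηK
      ((continuousOn_posPart_sub h1 h2).comp (f := fun x => (x, s)) (by fun_prop)
        fun x hx => ⟨(show R1 < ‖x‖ from hKR hx).le, hs⟩)
  rw [← hasDerivWithinAt_Ioi_iff_Ici, hasDerivWithinAt_iff_tendsto_slope' self_notMem_Ioi]
  have hslope : ∀ s ∈ Ioo t ((t + T1) / 2), (fun x => η x * slope (fun s => max (u1 x s - u2 x s) 0) t s)
      = fun x => (s - t)⁻¹ * (η x * max (u1 x s - u2 x s) 0 - η x * max (u1 x t - u2 x t) 0) :=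
    fun s hs => by
      funext x
      rw [slope_def_field]
      ring
  have hIs : ∀ s ∈ Ioo t ((t + T1) / 2), s ∈ Icc 0 T1 := fun s hs =>
    ⟨by linarith [ht.1, hs.1], by linarith [hs.2]⟩
  have hev : ∀ᶠ s in 𝓝[>] t, s ∈ Ioo t ((t + T1) / 2) := Ioo_mem_nhdsGT htT
  refine Tendsto.congr' (f₁ := fun s => ∫ x, η x * slope (fun s => max (u1 x s - u2 x s) 0) t s) ?_ ?_
  · filter_upwards [hev] with s hs
    rw [hslope s hs, integral_const_mul,
      integral_sub (hint s (hIs s hs)) (hint t (Ioo_subset_Icc_self ht)), slope_def_field,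
      inv_mul_eq_div]
  · refine tendsto_integral_filter_of_dominated_convergence (K.indicator fun _ => C1 + C2) ?_ ?_
      ((integrable_indicator_iff hK.measurableSet).2 (integrableOn_const hK.measure_lt_top.ne))
      (Eventually.of_forall fun x => ?_)
    · filter_upwards [hev] with s hs
      rw [hslope s hs]
      exact (((hint s (hIs s hs)).sub (hint t (Ioo_subset_Icc_self ht))).const_mul
        _).aestronglyMeasurable
    · filter_upwards [hev] with s hs
      refine Eventually.of_forall fun x => ?_
      by_cases hx : x ∈ K
      · rw [indicator_of_mem hx, norm_mul, Real.norm_of_nonneg (hη0 x), slope_def_field]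
        have hst : 0 < s - t := sub_pos.2 hs.1
        have hs' : s ∈ Icc t ((t + T1) / 2) := Ioo_subset_Icc_self hs
        have e := abs_max_sub_max_le_abs (u1 x s - u2 x s) (u1 x t - u2 x t) 0
        have e1 := hL1 x hx s hs'
        have e2 := hL2 x hx s hs'
        have e3 : |u1 x s - u2 x s - (u1 x t - u2 x t)| ≤ |u1 x s - u1 x t| + |u2 x s - u2 x t| := by
          rw [show u1 x s - u2 x s - (u1 x t - u2 x t) = (u1 x s - u1 x t) - (u2 x s - u2 x t) by ring]
          exact abs_sub _ _
        have e4 : ‖(max (u1 x s - u2 x s) 0 - max (u1 x t - u2 x t) 0) / (s - t)‖ ≤ C1 + C2 := by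
          rw [norm_div, Real.norm_eq_abs, Real.norm_of_nonneg hst.le, div_le_iff₀ hst]
          linarith
        calc _ ≤ 1 * (C1 + C2) := mul_le_mul (hη1 x) e4 (norm_nonneg _) zero_le_one
          _ = _ := one_mul _
      · simp [hx, hηK x hx]
    · by_cases hx : x ∈ K
      · have hd := ((h1.hasDerivAt (hKR hx) ht).sub (h2.hasDerivAt (hKR hx) ht))
        exact ((hasDerivWithinAt_iff_tendsto_slope' self_notMem_Ioi).1
          (hasDerivWithinAt_posPart hd)).const_mul _
      · simp [hηK x hx]

theorem integral_posPartDeriv_sub_le (h1 : IsExteriorSolution n m R1 T1 u1)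
    (h2 : IsExteriorSolution n m R1 T1 u2) (hm0 : 0 < m) {t : ℝ} (ht : t ∈ Ioo 0 T1)
    {a ρ k : ℝ} (ha : R1 < a) (haρ : a < ρ)
    (hlayer : ∀ x : EuclideanSpace ℝ (Fin n), R1 ≤ ‖x‖ → ‖x‖ ≤ ρ → u1 x t < u2 x t)
    {η : EuclideanSpace ℝ (Fin n) → ℝ} (hη : Continuous η) (hηc : HasCompactSupport η)
    (hη0 : ∀ x, 0 ≤ η x) (hηs : tsupport η ⊆ {x | a ≤ ‖x‖})
    {S : Set (EuclideanSpace ℝ (Fin n))} (hS : IsCompact S) (hSa : S ⊆ {x | a ≤ ‖x‖})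
    (hηS : ∀ᶠ h in 𝓝[>] (0 : ℝ), ∀ x, ρ < ‖x‖ →
      secondDiff η h x ≤ S.indicator (fun _ => k) x * h ^ 2) :
    ∫ x, η x * posPartDeriv (u1 x t - u2 x t)
        (lap n (fun y => u1 y t ^ m) x - lap n (fun y => u2 y t ^ m) x) ≤
      k * ∫ x in S, max (u1 x t ^ m - u2 x t ^ m) 0 := by
  have htc : t ∈ Ioc 0 T1 := Ioo_subset_Ioc_self ht
  have htI : t ∈ Icc 0 T1 := Ioo_subset_Icc_self ht
  set b := (R1 + a) / 2 with hb
  have hRb : R1 < b := by linarith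
  have hba : b < a := by linarith
  set w : EuclideanSpace ℝ (Fin n) → ℝ :=
    {x | b ≤ ‖x‖}.indicator fun x => u1 x t ^ m - u2 x t ^ m with hw
  have hwx : ∀ x, b ≤ ‖x‖ → w x = u1 x t ^ m - u2 x t ^ m := fun x hx =>
    indicator_of_mem (show x ∈ {x | b ≤ ‖x‖} from hx) _
  have hF1 := h1.contDiffOn_rpow htc
  have hF2 := h2.contDiffOn_rpow htc
  have hC := hF1.sub hF2
  have hsub : {x : EuclideanSpace ℝ (Fin n) | b ≤ ‖x‖} ⊆ {x | R1 < ‖x‖} := fun x hx =>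
    hRb.trans_le hx
  have hwm : Measurable w := by
    rw [hw, ← piecewise_eq_indicator]
    exact (hC.continuousOn.mono hsub).measurable_piecewise continuousOn_const
      (isClosed_le continuous_const continuous_norm).measurableSet
  have hwC : ContDiffOn ℝ 2 w {x | b < ‖x‖} :=
    (hC.mono fun x hx => hRb.trans hx).congr fun x hx => hwx x (le_of_lt hx)
  have hsign : ∀ x, R1 ≤ ‖x‖ → (u1 x t ^ m < u2 x t ^ m ↔ u1 x t < u2 x t) := fun x hx =>
    rpow_lt_rpow_iff (h1.pos x hx t htI).le (h2.pos x hx t htI).le hm0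
  have hsign' : ∀ x, R1 ≤ ‖x‖ → (u2 x t ^ m < u1 x t ^ m ↔ u2 x t < u1 x t) := fun x hx =>
    rpow_lt_rpow_iff (h2.pos x hx t htI).le (h1.pos x hx t htI).le hm0
  have hwρ : ∀ x, ‖x‖ ≤ ρ → w x ≤ 0 := fun x hx => by
    by_cases hxb : b ≤ ‖x‖
    · rw [hwx x hxb]
      have := (hsign x (hRb.le.trans hxb)).2 (hlayer x (hRb.le.trans hxb) hx)
      linarith
    · exact (indicator_of_notMem (show x ∉ {x | b ≤ ‖x‖} from hxb) _).le
  have hmain := integral_mul_posPartDeriv_lap_le hwm hwC (hba.trans haρ) hwρ hη hηc hη0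
    (fun x hx => hba.trans_le (hηs hx)) hS hηS
  refine (Eq.le ?_).trans (hmain.trans_eq ?_)
  · refine integral_congr_ae (Eventually.of_forall fun x => ?_)
    dsimp only
    by_cases hx : x ∈ tsupport η
    · have hxa : a ≤ ‖x‖ := hηs hx
      have hxb : b < ‖x‖ := hba.trans_le hxa
      have hxR : R1 < ‖x‖ := ha.trans_le hxa
      have hlapeq : lap n w x = lap n (fun y => u1 y t ^ m) x - lap n (fun y => u2 y t ^ m) x := by
        rw [← lap_sub (isOpen_exterior n R1) hF1 hF2 hxR]
        refine tendsto_nhds_unique (tendsto_secondDiff (isOpen_exterior n b) hwC hxb)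
          ((tendsto_secondDiff (isOpen_exterior n b) (hC.mono fun x hx => hRb.trans hx) hxb).congr'
            ?_)
        filter_upwards [Ioo_mem_nhdsGT (sub_pos.2 hxb)] with h hh
        have hnear : ∀ v : EuclideanSpace ℝ (Fin n), ‖v‖ = |h| → b ≤ ‖x + v‖ ∧ b ≤ ‖x - v‖ :=
          fun v hv => by
            rw [abs_of_pos hh.1] at hv
            have e1 := norm_sub_le (x + v) v
            have e2 := norm_add_le (x - v) v
            rw [add_sub_cancel_right] at e1
            rw [sub_add_cancel] at e2
            constructor <;> linarith [hh.2]
        congr 1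
        refine Finset.sum_congr rfl fun i _ => ?_
        obtain ⟨e1, e2⟩ := hnear _ (norm_smul_single i h)
        rw [hwx _ e1, hwx _ e2, hwx _ hxb.le]
      rw [hlapeq, hwx x hxb.le]
      congr 1
      rcases lt_trichotomy (u1 x t) (u2 x t) with h | h | h
      · rw [posPartDeriv_of_neg (sub_neg.2 h),
          posPartDeriv_of_neg (sub_neg.2 ((hsign x hxR.le).2 h))]
      · rw [h, sub_self, sub_self]
      · rw [posPartDeriv_of_pos (sub_pos.2 h),
          posPartDeriv_of_pos (sub_pos.2 ((hsign' x hxR.le).2 h))]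
    · simp [image_eq_zero_of_notMem_tsupport hx]
  · congr 1
    refine setIntegral_congr_fun hS.measurableSet fun x hx => ?_
    rw [hwx x (hba.le.trans (hSa hx))]

end IsExteriorSolution

theorem max_rpow_sub_rpow_le {m c r a b : ℝ} (hm0 : 0 < m) (hm1 : m < 1) (hc : 0 < c) (hr : 0 < r)
    (ha : c * r ^ (-(2 / (1 - m))) ≤ a) (hb : c * r ^ (-(2 / (1 - m))) ≤ b) :
    max (a ^ m - b ^ m) 0 ≤ m * c ^ (m - 1) * r ^ 2 * max (a - b) 0 := by
  have hl : 0 < c * r ^ (-(2 / (1 - m))) := by positivity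
  rcases le_total a b with hab | hab
  · have : a ^ m ≤ b ^ m := rpow_le_rpow (hl.le.trans ha) hab hm0.le
    rw [max_eq_right (by linarith), max_eq_right (by linarith), mul_zero]
  · have h := rpow_sub_rpow_le_mul_sub hm0.le hm1.le hl hb hab
    have e : (c * r ^ (-(2 / (1 - m)))) ^ (m - 1) = c ^ (m - 1) * r ^ 2 := by
      rw [mul_rpow hc.le (by positivity), ← rpow_mul hr.le, ← rpow_natCast r 2]
      congr 2
      have : 1 - m ≠ 0 := by linarith
      field_simp
      push_cast
      ring
    rw [e, ← mul_assoc] at h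
    have hab' : 0 ≤ a - b := sub_nonneg.2 hab
    rw [max_eq_left hab']
    exact max_le h (by positivity)

theorem intervalIntegral_setIntegral_le {n : ℕ} {G : EuclideanSpace ℝ (Fin n) × ℝ → ℝ}
    (hG0 : ∀ p, 0 ≤ G p) {S Q : Set (EuclideanSpace ℝ (Fin n))} {t₀ t₁ T : ℝ} (ht₀ : 0 < t₀)
    (ht₀₁ : t₀ ≤ t₁) (ht₁ : t₁ < T) (hSQ : S ⊆ Q) (hG : IntegrableOn G (Q ×ˢ Ioo 0 T)) :
    ∫ s in t₀..t₁, ∫ x in S, G (x, s) ≤ ∫ p in Q ×ˢ Ioo 0 T, G p := by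
  have hsub : S ×ˢ Ioc t₀ t₁ ⊆ Q ×ˢ Ioo 0 T :=
    prod_mono hSQ fun s hs => ⟨ht₀.trans hs.1, hs.2.trans_lt ht₁⟩
  have hG' : Integrable G ((volume.restrict S).prod (volume.restrict (Ioc t₀ t₁))) := by
    rw [Measure.prod_restrict, ← Measure.volume_eq_prod]
    exact hG.mono_set hsub
  rw [intervalIntegral.integral_of_le ht₀₁, ← integral_prod_symm _ hG', Measure.prod_restrict,
    ← Measure.volume_eq_prod]
  exact setIntegral_mono_set hG (Eventually.of_forall hG0) hsub.eventuallyLE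

theorem tendsto_setIntegral_exterior {n : ℕ} {G : EuclideanSpace ℝ (Fin n) × ℝ → ℝ} {R T : ℝ}
    (hG : IntegrableOn G ({x | R < ‖x‖} ×ˢ Ioo 0 T)) :
    Tendsto (fun r : ℝ => ∫ p in {x : EuclideanSpace ℝ (Fin n) | r ≤ ‖x‖} ×ˢ Ioo 0 T, G p) atTop
      (𝓝 0) := by
  have hm : ∀ r : ℝ, MeasurableSet ({x : EuclideanSpace ℝ (Fin n) | r ≤ ‖x‖} ×ˢ Ioo 0 T) :=
    fun r => (isClosed_le continuous_const continuous_norm).measurableSet.prod measurableSet_Ioo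
  have h := tendsto_setIntegral_of_antitone hm
    (fun r s hrs => prod_mono (fun x (hx : s ≤ ‖x‖) => hrs.trans hx) subset_rfl)
    ⟨R + 1, hG.mono_set (prod_mono (fun x (hx : R + 1 ≤ ‖x‖) => (lt_add_one R).trans_le hx)
      subset_rfl)⟩
  have hempty : ⋂ r : ℝ, {x : EuclideanSpace ℝ (Fin n) | r ≤ ‖x‖} ×ˢ Ioo 0 T = ∅ := by
    refine eq_empty_of_forall_notMem fun p hp => ?_
    have : ‖p.1‖ + 1 ≤ ‖p.1‖ := (mem_iInter.1 hp (‖p.1‖ + 1)).1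
    linarith
  rwa [hempty, setIntegral_empty] at h

namespace IsExteriorSolution

variable {n : ℕ} {m R1 T1 : ℝ} {u1 u2 : EuclideanSpace ℝ (Fin n) → ℝ → ℝ}

theorem continuousOn_setIntegral_posPart_sub (h1 : IsExteriorSolution n m R1 T1 u1)
    (h2 : IsExteriorSolution n m R1 T1 u2) {K : Set (EuclideanSpace ℝ (Fin n))}
    (hK : IsCompact K) (hKR : K ⊆ {x : EuclideanSpace ℝ (Fin n) | R1 ≤ ‖x‖}) :
    ContinuousOn (fun s => ∫ x in K, max (u1 x s - u2 x s) 0) (Icc 0 T1) :=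
  continuousOn_setIntegral_of_isCompact hK
    ((continuousOn_posPart_sub h1 h2).mono (prod_mono hKR subset_rfl))

theorem setIntegral_posPart_rpow_sub_le (h1 : IsExteriorSolution n m R1 T1 u1)
    (h2 : IsExteriorSolution n m R1 T1 u2) (hm0 : 0 < m) (hm1 : m < 1) (hR1 : 0 < R1)
    {c0 : ℝ} (hc0 : 0 < c0) (hlow : ∀ x : EuclideanSpace ℝ (Fin n), R1 ≤ ‖x‖ →
      ∀ t ∈ Icc 0 T1, c0 * ‖x‖ ^ (-(2 / (1 - m))) ≤ min (u1 x t) (u2 x t))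
    {r : ℝ} {S : Set (EuclideanSpace ℝ (Fin n))} (hS : IsCompact S)
    (hSR : S ⊆ {x : EuclideanSpace ℝ (Fin n) | R1 ≤ ‖x‖ ∧ ‖x‖ ≤ r}) {t : ℝ} (ht : t ∈ Icc 0 T1) :
    ∫ x in S, max (u1 x t ^ m - u2 x t ^ m) 0 ≤
      m * c0 ^ (m - 1) * r ^ 2 * ∫ x in S, max (u1 x t - u2 x t) 0 := by
  have hmap : MapsTo (fun x : EuclideanSpace ℝ (Fin n) => (x, t)) S
      ({x | R1 ≤ ‖x‖} ×ˢ Icc 0 T1) := fun x hx => ⟨(hSR hx).1, ht⟩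
  have i1 : IntegrableOn (fun x => max (u1 x t ^ m - u2 x t ^ m) 0) S :=
    (((h1.continuousOn_rpow.sub h2.continuousOn_rpow).sup (continuousOn_const (c := (0 : ℝ)))).comp
      (f := fun x => (x, t)) (by fun_prop) hmap).integrableOn_compact hS
  have i2 : IntegrableOn (fun x => max (u1 x t - u2 x t) 0) S :=
    ((continuousOn_posPart_sub h1 h2).comp (f := fun x => (x, t))
      (by fun_prop) hmap).integrableOn_compact hS
  rw [← integral_const_mul]
  refine setIntegral_mono_on i1 (i2.const_mul _) hS.measurableSet fun x hx => ?_
  have hx' := hSR hx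
  have hx0 : 0 < ‖x‖ := hR1.trans_le hx'.1
  have hl := le_min_iff.1 (hlow x hx'.1 t ht)
  refine (max_rpow_sub_rpow_le hm0 hm1 hc0 hx0 hl.1 hl.2).trans ?_
  have := hx'.2
  gcongr

/-- Integrated form of Kato's inequality: growth of the localized mass of the positive part is
controlled by the mass in the outer transition region of the cutoff. -/
theorem integral_mul_posPart_sub_le (h1 : IsExteriorSolution n m R1 T1 u1)
    (h2 : IsExteriorSolution n m R1 T1 u2) (hm0 : 0 < m) (hm1 : m < 1) (hR1 : 0 < R1)
    {c0 : ℝ} (hc0 : 0 < c0) (hlow : ∀ x : EuclideanSpace ℝ (Fin n), R1 ≤ ‖x‖ →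
      ∀ t ∈ Icc 0 T1, c0 * ‖x‖ ^ (-(2 / (1 - m))) ≤ min (u1 x t) (u2 x t))
    {t₀ t₁ a ρ R C : ℝ} (ht₀ : 0 < t₀) (ht₀₁ : t₀ ≤ t₁) (ht₁ : t₁ < T1) (ha : R1 < a) (haρ : a < ρ)
    (hlayer : ∀ x : EuclideanSpace ℝ (Fin n), R1 ≤ ‖x‖ → ‖x‖ ≤ ρ →
      ∀ t ∈ Icc t₀ T1, u1 x t < u2 x t) (hC : 0 ≤ C) (haR : a ≤ R / 2)
    {η : EuclideanSpace ℝ (Fin n) → ℝ} (hη : Continuous η) (hηc : HasCompactSupport η)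
    (hη0 : ∀ x, 0 ≤ η x) (hη1 : ∀ x, η x ≤ 1)
    (hηs : tsupport η ⊆ {x | a ≤ ‖x‖ ∧ ‖x‖ ≤ 2 * R})
    (hηS : ∀ᶠ h in 𝓝[>] (0 : ℝ), ∀ x, ρ < ‖x‖ → secondDiff η h x ≤
      {x : EuclideanSpace ℝ (Fin n) | R / 2 ≤ ‖x‖ ∧ ‖x‖ ≤ 3 * R}.indicator
        (fun _ => C / R ^ 2) x * h ^ 2) :
    ∫ x, η x * max (u1 x t₁ - u2 x t₁) 0 ≤ (∫ x, η x * max (u1 x t₀ - u2 x t₀) 0) +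
      9 * C * (m * c0 ^ (m - 1)) * ∫ s in t₀..t₁,
        ∫ x in {x : EuclideanSpace ℝ (Fin n) | R / 2 ≤ ‖x‖ ∧ ‖x‖ ≤ 3 * R},
          max (u1 x s - u2 x s) 0 := by
  have hR : 0 < R := by linarith
  have hS := isCompact_shell n (R / 2) (3 * R)
  have hK := isCompact_shell n a (2 * R)
  set S := {x : EuclideanSpace ℝ (Fin n) | R / 2 ≤ ‖x‖ ∧ ‖x‖ ≤ 3 * R} with hSdef
  set K := {x : EuclideanSpace ℝ (Fin n) | a ≤ ‖x‖ ∧ ‖x‖ ≤ 2 * R} with hKdef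
  have hηK : ∀ x, x ∉ K → η x = 0 := fun x hx =>
    image_eq_zero_of_notMem_tsupport fun h => hx (hηs h)
  have hKR : K ⊆ {x : EuclideanSpace ℝ (Fin n) | R1 < ‖x‖} := fun x hx => ha.trans_le hx.1
  have hSR : S ⊆ {x : EuclideanSpace ℝ (Fin n) | R1 ≤ ‖x‖ ∧ ‖x‖ ≤ 3 * R} := fun x hx =>
    ⟨(ha.le.trans haR).trans hx.1, hx.2⟩
  set b : ℝ → ℝ := fun s => ∫ x in S, max (u1 x s - u2 x s) 0 with hb
  have hbc : ContinuousOn b (Icc 0 T1) :=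
    continuousOn_setIntegral_posPart_sub h1 h2 hS fun x hx => (hSR hx).1
  have hIo : Icc t₀ t₁ ⊆ Ioo 0 T1 := fun s hs => ⟨ht₀.trans_le hs.1, hs.2.trans_lt ht₁⟩
  have hBd : ∀ s ∈ Icc t₀ t₁, HasDerivAt (fun s => (∫ x, η x * max (u1 x t₀ - u2 x t₀) 0) +
      9 * C * (m * c0 ^ (m - 1)) * ∫ r in t₀..s, b r) (9 * C * (m * c0 ^ (m - 1)) * b s) s := by
    intro s hs
    refine HasDerivAt.const_add _ (HasDerivAt.const_mul _ ?_)
    refine intervalIntegral.integral_hasDerivAt_right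
      (ContinuousOn.intervalIntegrable (hbc.mono ?_))
      ((hbc.mono Ioo_subset_Icc_self).stronglyMeasurableAtFilter isOpen_Ioo s (hIo hs))
      (hbc.continuousAt (Icc_mem_nhds (hIo hs).1 (hIo hs).2))
    rw [uIcc_of_le hs.1]
    exact fun r hr => ⟨ht₀.le.trans hr.1, hr.2.trans (hIo hs).2.le⟩
  refine image_le_of_deriv_right_le_deriv_boundary (f := fun s => ∫ x, η x * max (u1 x s - u2 x s) 0)
    (f' := fun t => ∫ x, η x * posPartDeriv (u1 x t - u2 x t)
        (lap n (fun y => u1 y t ^ m) x - lap n (fun y => u2 y t ^ m) x))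
    (B := fun s => (∫ x, η x * max (u1 x t₀ - u2 x t₀) 0) +
      9 * C * (m * c0 ^ (m - 1)) * ∫ r in t₀..s, b r)
    (B' := fun s => 9 * C * (m * c0 ^ (m - 1)) * b s) ?_ ?_ ?_ ?_ ?_ ?_ ⟨ht₀₁, le_rfl⟩
  · have hc : ContinuousOn (fun s => ∫ x in K, η x * max (u1 x s - u2 x s) 0) (Icc t₀ t₁) :=
      continuousOn_setIntegral_of_isCompact (G := fun x s => η x * max (u1 x s - u2 x s) 0) hK
        (ContinuousOn.mul (by fun_prop) ((continuousOn_posPart_sub h1 h2).mono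
          (prod_mono (fun x hx => (show R1 < ‖x‖ from hKR hx).le)
            (hIo.trans Ioo_subset_Icc_self))))
    refine hc.congr fun s _ => ?_
    exact (setIntegral_eq_integral_of_forall_compl_eq_zero fun x hx => by
      rw [hηK x hx, zero_mul]).symm
  · exact fun s hs => hasDerivWithinAt_integral_posPart_sub h1 h2 hm0 hm1 hK hKR hη hηK hη0 hη1
      (hIo (Ico_subset_Icc_self hs))
  · simp
  · exact fun s hs => (hBd s hs).continuousAt.continuousWithinAt
  · exact fun s hs => (hBd s (Ico_subset_Icc_self hs)).hasDerivWithinAt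
  · intro s hs
    have hsT : s ∈ Ioo 0 T1 := hIo (Ico_subset_Icc_self hs)
    refine (integral_posPartDeriv_sub_le h1 h2 hm0 hsT ha haρ
      (fun x hx hxρ => hlayer x hx hxρ s ⟨hs.1, hsT.2.le⟩) hη hηc hη0 (fun x hx => (hηs hx).1) hS
      (fun x hx => haR.trans hx.1) hηS).trans ?_
    have h3 := mul_le_mul_of_nonneg_left (setIntegral_posPart_rpow_sub_le h1 h2 hm0 hm1 hR1 hc0
      hlow hS hSR (Ioo_subset_Icc_self hsT)) (show 0 ≤ C / R ^ 2 by positivity)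
    refine h3.trans_eq ?_
    simp only [hb]
    field_simp
    ring

/-- Weak comparison: the positive part of `u1 - u2`, being integrable, vanishes. -/
theorem le_of_integrableOn (h1 : IsExteriorSolution n m R1 T1 u1)
    (h2 : IsExteriorSolution n m R1 T1 u2) (hm0 : 0 < m) (hm1 : m < 1) (hR1 : 0 < R1)
    (hinit : ∀ x : EuclideanSpace ℝ (Fin n), R1 ≤ ‖x‖ → u1 x 0 ≤ u2 x 0)
    (hbdry : ∀ x : EuclideanSpace ℝ (Fin n), ‖x‖ = R1 → ∀ t ∈ Ioc 0 T1, u1 x t < u2 x t)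
    {c0 : ℝ} (hc0 : 0 < c0) (hlow : ∀ x : EuclideanSpace ℝ (Fin n), R1 ≤ ‖x‖ →
      ∀ t ∈ Icc 0 T1, c0 * ‖x‖ ^ (-(2 / (1 - m))) ≤ min (u1 x t) (u2 x t))
    (hL1 : IntegrableOn
      (fun p : EuclideanSpace ℝ (Fin n) × ℝ => max (u1 p.1 p.2 - u2 p.1 p.2) 0)
      ({x : EuclideanSpace ℝ (Fin n) | R1 < ‖x‖} ×ˢ Ioo 0 T1))
    {x : EuclideanSpace ℝ (Fin n)} (hx : R1 < ‖x‖) {t : ℝ} (ht : t ∈ Ioo 0 T1) :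
    u1 x t ≤ u2 x t := by
  by_contra! hlt
  set γ := (u1 x t - u2 x t) / 2 with hγ
  have hγ0 : 0 < γ := by rw [hγ]; linarith
  have htI : t ∈ Icc 0 T1 := Ioo_subset_Icc_self ht
  set b₀ := (R1 + ‖x‖) / 2 with hb₀
  have hRb₀ : R1 < b₀ := by rw [hb₀]; linarith
  have hb₀x : b₀ < ‖x‖ := by rw [hb₀]; linarith
  have hcat : ContinuousAt (fun y => u1 y t - u2 y t) x :=
    ((h1.smoothSpace t (Ioo_subset_Ioc_self ht)).continuousOn.continuousAt
      (exterior_mem_nhds hx)).sub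
      ((h2.smoothSpace t (Ioo_subset_Ioc_self ht)).continuousOn.continuousAt (exterior_mem_nhds hx))
  obtain ⟨r, hr, hball⟩ := Metric.eventually_nhds_iff_ball.1
    ((hcat.eventually_const_lt (show γ < u1 x t - u2 x t by rw [hγ]; linarith)).and
      (exterior_mem_nhds hb₀x))
  set V := Metric.ball x r with hV
  set θ := volume.real V * γ with hθ
  have hθ0 : 0 < θ :=
    mul_pos (ENNReal.toReal_pos (Metric.measure_ball_pos volume x hr).ne' measure_ball_lt_top.ne) hγ0
  obtain ⟨C, hC, hcut⟩ := exists_cutoff n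
  set κ := 9 * C * (m * c0 ^ (m - 1)) with hκ
  have hκ0 : 0 ≤ κ := by positivity
  set G : EuclideanSpace ℝ (Fin n) × ℝ → ℝ := fun p => max (u1 p.1 p.2 - u2 p.1 p.2) 0 with hG
  have htail := (tendsto_setIntegral_exterior hL1).const_mul κ
  rw [mul_zero] at htail
  obtain ⟨q, hq1, hq2⟩ := ((htail.eventually_lt_const (half_pos hθ0)).and
    (eventually_gt_atTop (‖x‖ + r))).exists
  set R := 2 * q with hR
  have hqR : R / 2 = q := by rw [hR]; ring
  have hJ := continuousOn_setIntegral_posPart_sub h1 h2 (isCompact_shell n R1 (2 * R))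
    fun y hy => hy.1
  have hT1 : 0 < T1 := ht.1.trans ht.2
  have hJ0 : ∫ y in {y : EuclideanSpace ℝ (Fin n) | R1 ≤ ‖y‖ ∧ ‖y‖ ≤ 2 * R},
      max (u1 y 0 - u2 y 0) 0 = 0 :=
    setIntegral_eq_zero_of_forall_eq_zero fun y hy =>
      max_eq_right (sub_nonpos.2 (hinit y hy.1))
  have hJt : Tendsto (fun s => ∫ y in {y : EuclideanSpace ℝ (Fin n) | R1 ≤ ‖y‖ ∧ ‖y‖ ≤ 2 * R},
      max (u1 y s - u2 y s) 0) (𝓝[>] 0) (𝓝 0) := by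
    have h := (hJ 0 ⟨le_rfl, hT1.le⟩).tendsto
    rw [hJ0] at h
    exact h.mono_left (nhdsWithin_le_of_mem (Icc_mem_nhdsGT hT1))
  obtain ⟨t₀, hJt₀, ht₀⟩ := ((hJt.eventually_lt_const (half_pos hθ0)).and
    (Ioo_mem_nhdsGT ht.1)).exists
  obtain ⟨ρ, hRρ, hρb, hlayer⟩ := exists_layer h1 h2 hbdry ht₀.1 hRb₀
  set a := R1 + (ρ - R1) / 3 with ha
  set b := R1 + 2 * (ρ - R1) / 3 with hb
  have hqx : ‖x‖ < q := by linarith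
  obtain ⟨η, hη, hηc, hη0, hη1, hη1', hηs, hηS⟩ := hcut a b ρ R (by linarith) (by linarith)
    (by linarith) (by linarith)
  have hmain := integral_mul_posPart_sub_le h1 h2 hm0 hm1 hR1 hc0 hlow ht₀.1 ht₀.2.le ht.2
    (by linarith) (by linarith) hlayer hC (by linarith) hη hηc hη0 hη1 hηs hηS
  have hηK : ∀ y, y ∉ {y : EuclideanSpace ℝ (Fin n) | R1 ≤ ‖y‖ ∧ ‖y‖ ≤ 2 * R} → η y = 0 :=
    fun y hy => image_eq_zero_of_notMem_tsupport fun h =>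
      hy ⟨by linarith [(hηs h).1], (hηs h).2⟩
  have hslice : ∀ s ∈ Icc 0 T1, ContinuousOn (fun y => max (u1 y s - u2 y s) 0)
      {y : EuclideanSpace ℝ (Fin n) | R1 ≤ ‖y‖ ∧ ‖y‖ ≤ 2 * R} := fun s hs =>
    (continuousOn_posPart_sub h1 h2).comp (f := fun y => (y, s)) (by fun_prop)
      fun y hy => ⟨hy.1, hs⟩
  have hlower : θ ≤ ∫ y, η y * max (u1 y t - u2 y t) 0 := by
    have hint := integrable_mul_of_continuousOn (isCompact_shell n R1 (2 * R)) hη hηK (hslice t htI)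
    calc θ = ∫ _ in V, γ := by rw [setIntegral_const, smul_eq_mul]
      _ ≤ ∫ y in V, η y * max (u1 y t - u2 y t) 0 := by
        refine setIntegral_mono_on (integrableOn_const measure_ball_lt_top.ne) hint.integrableOn
          measurableSet_ball fun y hy => ?_
        obtain ⟨e1, e2⟩ := hball y hy
        have e2' : b₀ < ‖y‖ := e2
        have e3 : ‖y - x‖ < r := by rwa [← dist_eq_norm]
        have e4 := norm_sub_norm_le y x
        rw [hη1' y (by linarith) (by linarith), one_mul]
        exact e1.le.trans (le_max_left _ _)
      _ ≤ _ := setIntegral_le_integral hint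
        (Eventually.of_forall fun y => mul_nonneg (hη0 y) (le_max_right _ _))
  have hupper : ∫ y, η y * max (u1 y t₀ - u2 y t₀) 0 < θ / 2 := by
    have ht₀I : t₀ ∈ Icc 0 T1 := ⟨ht₀.1.le, ht₀.2.le.trans ht.2.le⟩
    have hint := integrable_mul_of_continuousOn (isCompact_shell n R1 (2 * R)) hη hηK
      (hslice t₀ ht₀I)
    refine lt_of_le_of_lt ?_ hJt₀
    rw [← setIntegral_eq_integral_of_forall_compl_eq_zero (fun y hy => by
      rw [hηK y hy, zero_mul] : ∀ y, y ∉ {y : EuclideanSpace ℝ (Fin n) | R1 ≤ ‖y‖ ∧ ‖y‖ ≤ 2 * R} →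
        η y * max (u1 y t₀ - u2 y t₀) 0 = 0)]
    exact setIntegral_mono_on hint.integrableOn
      ((hslice t₀ ht₀I).integrableOn_compact (isCompact_shell n R1 (2 * R)))
      (isCompact_shell n R1 (2 * R)).measurableSet fun y _ =>
        mul_le_of_le_one_left (le_max_right _ _) (hη1 y)
  have htail' := mul_le_mul_of_nonneg_left (intervalIntegral_setIntegral_le (G := G)
    (S := {x : EuclideanSpace ℝ (Fin n) | R / 2 ≤ ‖x‖ ∧ ‖x‖ ≤ 3 * R})
    (Q := {x : EuclideanSpace ℝ (Fin n) | q ≤ ‖x‖})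
    (fun p => le_max_right _ _) ht₀.1 ht₀.2.le ht.2 (fun y hy => hqR.symm.le.trans hy.1)
    (hL1.mono_set (prod_mono (fun y (hy : q ≤ ‖y‖) => (hx.trans hqx).trans_le hy) subset_rfl))) hκ0
  linarith

end IsExteriorSolution

/-- Strong comparison principle for the fast diffusion equation in an exterior domain. -/
theorem strong_comparison_exterior (n : ℕ) (m R1 T1 : ℝ) (hn : 3 ≤ n) (hm0 : 0 < m)
    (hm1 : m < ((n : ℝ) - 2) / n) (hR1 : 0 < R1) (hT1 : 0 < T1)
    (u1 u2 : EuclideanSpace ℝ (Fin n) → ℝ → ℝ)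
    (h1 : IsExteriorSolution n m R1 T1 u1) (h2 : IsExteriorSolution n m R1 T1 u2)
    (hinit : ∀ x : EuclideanSpace ℝ (Fin n), R1 ≤ ‖x‖ → u1 x 0 ≤ u2 x 0)
    (hbdry : ∀ x : EuclideanSpace ℝ (Fin n), ‖x‖ = R1 → ∀ t ∈ Set.Ioc 0 T1,
      u1 x t < u2 x t)
    (hlow : ∃ c0 : ℝ, 0 < c0 ∧ ∀ x : EuclideanSpace ℝ (Fin n), R1 ≤ ‖x‖ →
      ∀ t ∈ Set.Icc 0 T1, c0 * ‖x‖ ^ (-(2 / (1 - m))) ≤ min (u1 x t) (u2 x t))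
    (hL1 : IntegrableOn
      (fun p : EuclideanSpace ℝ (Fin n) × ℝ => max (u1 p.1 p.2 - u2 p.1 p.2) 0)
      ({x : EuclideanSpace ℝ (Fin n) | R1 < ‖x‖} ×ˢ Set.Ioo 0 T1)) :
    ∀ x : EuclideanSpace ℝ (Fin n), R1 < ‖x‖ → ∀ t ∈ Set.Ioc 0 T1, u1 x t < u2 x t := by
  have hm1' : m < 1 := by
    have hn0 : (0 : ℝ) < n := by exact_mod_cast (by omega : 0 < n)
    refine hm1.trans ((div_lt_one hn0).2 (by linarith))
  obtain ⟨c0, hc0, hlow⟩ := hlow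
  intro x hx t ht
  exact h1.lt_of_le h2 hm0 hm1' hR1 hbdry
    (fun y hy s hs => h1.le_of_integrableOn h2 hm0 hm1' hR1 hinit hbdry hc0 hlow hL1 hy hs) hx ht
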